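/- arXiv:1503.08368 — 5 statements merged into one kernel-verified Lean document; each statement's English description precedes it below -/
import Mathlib

section
/- For all integers n ≥ 1 and a ≥ 1, the characteristic polynomial of the a-handed riffle shuffle transition matrix P_a on S_n (a matrix over ℚ indexed by S_n) equals ∏_{σ ∈ S_n} (X − a^{c(σ) − n}), where c(σ) is the number of cycles of σ (counting each fixed point as a cycle of length 1). Equivalently, for each partition λ of n, the eigenvalue a^{ℓ(λ) − n} occurs with multiplicity equal to the number of permutations in S_n of cycle type λ, where ℓ(λ) is the number of parts of λ. -/
open Finset

/-- 0-indexed descent set of a deck arrangement: `i ∈ desSet n σ` iff the card at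
position `i` is greater than the card at position `i+1` (positions `0, …, n-2`). -/
def desSet (n : ℕ) (σ : Equiv.Perm (Fin n)) : Finset ℕ :=
  (Finset.range (n - 1)).filter
    (fun i => ∃ h : i + 1 < n, σ ⟨i + 1, h⟩ < σ ⟨i, Nat.lt_of_succ_lt h⟩)

/-- `des σ` is the number of descents of `σ`. -/
def des (n : ℕ) (σ : Equiv.Perm (Fin n)) : ℕ := (desSet n σ).card

/-- Bayer–Diaconis `a`-handed riffle shuffle transition matrix on `S_n`:
`Pa n a σ τ = C(n + a - 1 - des(τ⁻¹∘σ), n) / a^n`. -/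
def Pa (n a : ℕ) : Matrix (Equiv.Perm (Fin n)) (Equiv.Perm (Fin n)) ℚ :=
  fun σ τ => ((n + a - 1 - des n (τ⁻¹ * σ)).choose n : ℚ) / (a : ℚ) ^ n

/-- number of cycles of `σ`, counting each fixed point as a cycle of length 1 -/
def cyclesCount (n : ℕ) (σ : Equiv.Perm (Fin n)) : ℕ :=
  σ.cycleType.card + (n - σ.support.card)


/-! ### Linear algebra: traces of powers determine the characteristic polynomial -/

section LinAlg

open Polynomial

variable {K : Type*} [Field K] [IsAlgClosed K] {ι : Type*} [Fintype ι] [DecidableEq ι]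

theorem det_aeval_eq (A : Matrix ι ι K) (q : K[X]) :
    (aeval A q).det = (A.charpoly.roots.map (fun x => q.eval x)).prod := by
  have hcard : A.charpoly.roots.card = Fintype.card ι := by
    rw [← A.charpoly_natDegree_eq_dim]
    exact (IsAlgClosed.splits A.charpoly).natDegree_eq_card_roots.symm
  have hprod : A.charpoly = (A.charpoly.roots.map (fun x => X - C x)).prod :=
    (IsAlgClosed.splits A.charpoly).eq_prod_roots_of_monic A.charpoly_monic
  have hX : ∀ c : K, (aeval A (X - C c)).det =
      (A.charpoly.roots.map (fun x => (X - C c).eval x)).prod := by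
    intro c
    have h1 : A.charpoly.eval c = (Matrix.scalar ι c - A).det := Matrix.eval_charpoly A c
    have h2 : aeval A (X - C c) = -(Matrix.scalar ι c - A) := by
      simp [Matrix.algebraMap_eq_diagonal, Pi.algebraMap_def]
    rw [h2, Matrix.det_neg, ← h1]
    conv_lhs => rw [hprod]
    rw [eval_multiset_prod, Multiset.map_map, ← hcard]
    generalize A.charpoly.roots = s
    induction s using Multiset.induction_on with
    | empty => simp
    | cons x s ih =>
      simp only [Multiset.map_cons, Multiset.prod_cons, Multiset.card_cons, pow_succ,
        ← ih]
      simp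
      ring
  have hq := (IsAlgClosed.splits q).eq_prod_roots
  rw [hq]
  generalize q.roots = r
  generalize q.leadingCoeff = l
  induction r using Multiset.induction_on with
  | empty => simp [hcard, Algebra.algebraMap_eq_smul_one]
  | cons c r ih =>
    have : C l * (Multiset.map (fun a => X - C a) (c ::ₘ r)).prod
      = (X - C c) * (C l * (Multiset.map (fun a => X - C a) r).prod) := by
      rw [Multiset.map_cons, Multiset.prod_cons]; ring
    rw [this, map_mul, Matrix.det_mul, ih, hX, ← Multiset.prod_map_mul]
    simp only [eval_mul]

theorem trace_aeval_eq (A : Matrix ι ι K) (q : K[X]) :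
    (aeval A q).trace = (A.charpoly.roots.map (fun x => q.eval x)).sum := by
  have h : (aeval A q).charpoly =
      ((A.charpoly.roots.map (fun x => q.eval x)).map (fun y => X - C y)).prod := by
    apply Polynomial.funext
    intro t
    rw [Matrix.eval_charpoly, eval_multiset_prod]
    have : Matrix.scalar ι t - aeval A q = aeval A (C t - q) := by
      simp [Matrix.algebraMap_eq_diagonal, Pi.algebraMap_def]
    rw [this, det_aeval_eq]
    simp [Multiset.map_map]
  rw [Matrix.trace_eq_sum_roots_charpoly, h, roots_multiset_prod_X_sub_C]

theorem multiset_eq_of_sums {K : Type*} [Field K] [CharZero K] (μ ν : Multiset K)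
    (h : ∀ q : K[X], (μ.map (fun x => q.eval x)).sum = (ν.map (fun x => q.eval x)).sum) :
    μ = ν := by
  classical
  ext x
  set S := (μ.toFinset ∪ ν.toFinset).erase x
  set q : K[X] := ∏ y ∈ S, (X - C y)
  have hx : q.eval x ≠ 0 := by
    rw [eval_prod, Finset.prod_ne_zero_iff]
    intro y hy
    have : y ≠ x := Finset.ne_of_mem_erase hy
    simpa [sub_eq_zero] using this.symm
  have key : ∀ m : Multiset K, (∀ y ∈ m, y ∈ μ.toFinset ∪ ν.toFinset) →
      (m.map (fun x => q.eval x)).sum = (m.count x : K) * q.eval x := by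
    intro m
    induction m using Multiset.induction_on with
    | empty => simp
    | cons y m ih =>
      intro hm
      rw [Multiset.map_cons, Multiset.sum_cons, ih fun z hz => hm z (Multiset.mem_cons_of_mem hz)]
      by_cases hy : x = y
      · subst hy
        simp; ring
      · rw [Multiset.count_cons_of_ne hy]
        have : q.eval y = 0 := by
          rw [eval_prod]
          apply Finset.prod_eq_zero (i := y)
          · exact Finset.mem_erase.2 ⟨Ne.symm hy, hm y (Multiset.mem_cons_self _ _)⟩
          · simp
        simp [this]
  have := h q
  rw [key μ (by intro y hy; simp [hy]), key ν (by intro y hy; simp [hy])] at this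
  exact_mod_cast mul_right_cancel₀ hx this

end LinAlg

open Polynomial in
theorem charpoly_eq_of_trace_pow {ι : Type*} [Fintype ι] [DecidableEq ι] (A : Matrix ι ι ℚ)
    (l : ι → ℚ) (h : ∀ k : ℕ, (A ^ k).trace = ∑ i, l i ^ k) :
    A.charpoly = ∏ i, (X - C (l i)) := by
  let φ : ℚ →+* AlgebraicClosure ℚ := algebraMap _ _
  have hroots : (A.map φ).charpoly.roots = (Finset.univ.val.map fun i => φ (l i)) := by
    apply multiset_eq_of_sums
    intro q
    rw [← trace_aeval_eq, Multiset.map_map]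
    induction q using Polynomial.induction_on' with
    | add p q hp hq => simp only [map_add, Matrix.trace_add, hp, hq, Function.comp, eval_add,
        Multiset.sum_map_add]
    | monomial k c =>
      have ht : ((A ^ k).map φ).trace = φ ((A ^ k).trace) := by
        simp [Matrix.trace]
      rw [aeval_monomial, ← Algebra.smul_def, Matrix.trace_smul, ← Matrix.map_pow, ht, h]
      simp [Finset.mul_sum]
  apply Polynomial.map_injective φ φ.injective
  rw [← Matrix.charpoly_map, (IsAlgClosed.splits (A.map φ).charpoly).eq_prod_roots_of_monic
    (Matrix.charpoly_monic _), hroots, Polynomial.map_prod]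
  simp [Function.comp]
  try rfl

theorem inv_self_app {α : Type*} (e : Equiv.Perm α) (x : α) : e⁻¹ (e x) = x :=
  e.symm_apply_apply x

/-! ### Counting words by their sorting permutation -/

theorem eq_sort_iff_lex {n : ℕ} {α : Type*} [LinearOrder α] (v : Fin n → α)
    (h : Equiv.Perm (Fin n)) :
    Tuple.sort v = h ↔ StrictMono (fun k => toLex (v (h k), h k)) :=
  eq_comm.trans (Tuple.eq_sort_iff'.trans Iff.rfl)

theorem card_strictMono_fin (n m : ℕ) :
    (Finset.univ.filter (fun t : Fin n → Fin m => StrictMono t)).card = m.choose n := by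
  have : (Finset.powersetCard n (Finset.univ : Finset (Fin m))).card = m.choose n := by simp
  rw [← this]
  refine Finset.card_bij' (fun t _ => Finset.univ.image t)
    (fun s hs => s.orderEmbOfFin (Finset.mem_powersetCard.1 hs).2) ?_ ?_ ?_ ?_
  · intro t ht
    have ht' : StrictMono t := (Finset.mem_filter.1 ht).2
    simp [Finset.mem_powersetCard, Finset.card_image_of_injective _ ht'.injective]
  · intro s hs
    simp [OrderEmbedding.strictMono]
  · intro t ht
    have ht' : StrictMono t := (Finset.mem_filter.1 ht).2
    exact (Finset.orderEmbOfFin_unique _ (by simp) ht').symm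
  · intro s hs
    simp

/-- number of descents before position `k` -/
def desBefore (n : ℕ) (h : Equiv.Perm (Fin n)) (k : ℕ) : ℕ :=
  ((desSet n h).filter (fun j => j < k)).card

theorem desBefore_le (n : ℕ) (h : Equiv.Perm (Fin n)) (k : ℕ) : desBefore n h k ≤ k := by
  have : (desSet n h).filter (fun j => j < k) ⊆ Finset.range k := by
    intro j; simp
  simpa [desBefore] using Finset.card_le_card this

theorem desBefore_succ (n : ℕ) (h : Equiv.Perm (Fin n)) (k : ℕ) :
    desBefore n h (k + 1) = desBefore n h k + if k ∈ desSet n h then 1 else 0 := by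
  unfold desBefore
  split_ifs with hk
  · have : (desSet n h).filter (fun j => j < k + 1) =
        insert k ((desSet n h).filter (fun j => j < k)) := by
      ext j; simp only [Finset.mem_filter, Finset.mem_insert]
      constructor
      · rintro ⟨a, b⟩
        by_cases hj : j = k
        · exact Or.inl hj
        · exact Or.inr ⟨a, by omega⟩
      · rintro (rfl | ⟨a, b⟩)
        · exact ⟨hk, by omega⟩
        · exact ⟨a, by omega⟩
    rw [this, Finset.card_insert_of_notMem (by simp)]
  · rw [add_zero]
    congr 1
    ext j; simp only [Finset.mem_filter]
    constructor
    · rintro ⟨a, b⟩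
      refine ⟨a, ?_⟩
      have : j ≠ k := by rintro rfl; exact hk a
      omega
    · rintro ⟨a, b⟩
      exact ⟨a, by omega⟩

theorem desBefore_last (m : ℕ) (h : Equiv.Perm (Fin (m + 1))) :
    desBefore (m + 1) h m = des (m + 1) h := by
  unfold desBefore des
  congr 1
  apply Finset.filter_true_of_mem
  intro j hj
  have := (Finset.mem_filter.1 hj).1
  simpa using this

theorem desBefore_mono (n : ℕ) (h : Equiv.Perm (Fin n)) : Monotone (desBefore n h) :=
  monotone_nat_of_le_succ fun k => by rw [desBefore_succ]; omega

theorem sub_desBefore_mono (n : ℕ) (h : Equiv.Perm (Fin n)) :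
    Monotone (fun k => k - desBefore n h k) :=
  monotone_nat_of_le_succ fun k => by
    rw [desBefore_succ]; split_ifs <;> omega

theorem mem_desSet_iff (m : ℕ) (h : Equiv.Perm (Fin (m + 1))) (i : Fin m) :
    (i : ℕ) ∈ desSet (m + 1) h ↔ h i.succ < h i.castSucc := by
  unfold desSet
  simp only [Finset.mem_filter, Finset.mem_range]
  constructor
  · rintro ⟨_, _, h3⟩; exact h3
  · intro h3; exact ⟨by have := i.2; omega, by have := i.2; omega, h3⟩

theorem sort_eq_iff_local (m a : ℕ) (h : Equiv.Perm (Fin (m + 1))) (v : Fin (m + 1) → Fin a) :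
    Tuple.sort v = h ↔ ∀ i : Fin m, (v (h i.castSucc) : ℕ) +
      (if (i : ℕ) ∈ desSet (m + 1) h then 1 else 0) ≤ v (h i.succ) := by
  rw [eq_sort_iff_lex, Fin.strictMono_iff_lt_succ]
  refine forall_congr' fun i => ?_
  rw [Prod.Lex.toLex_lt_toLex]
  simp only [mem_desSet_iff]
  have hne : h i.castSucc ≠ h i.succ := by
    intro he
    exact (Fin.castSucc_lt_succ (i := i)).ne (h.injective he)
  split_ifs with hd
  · constructor
    · rintro (h1 | ⟨h1, h2⟩)
      · exact h1
      · exact absurd h2 (not_lt.2 hd.le)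
    · intro h1; exact Or.inl h1
  · have hlt : h i.castSucc < h i.succ := lt_of_le_of_ne (not_lt.1 hd) hne
    simp only [hlt, and_true, add_zero]
    rw [← le_iff_lt_or_eq]; rfl

theorem strictMono_add_le {m M : ℕ} {t : Fin (m + 1) → Fin M} (ht : StrictMono t)
    (i j : Fin (m + 1)) (hij : i ≤ j) : (t i : ℕ) + (j - i : ℕ) ≤ t j := by
  induction j using Fin.induction with
  | zero =>
    have : i = 0 := by simpa using hij
    subst this; simp
  | succ j ih =>
    rcases hij.lt_or_eq with h | h
    · have h1 : i ≤ j.castSucc := Fin.le_castSucc_iff.2 h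
      have h2 := ih h1
      have h3 : (t j.castSucc : ℕ) < t j.succ := ht Fin.castSucc_lt_succ
      have h4 : (i : ℕ) ≤ j := h1
      simp only [Fin.val_castSucc, Fin.val_succ] at *
      omega
    · subst h; simp

theorem card_sort (n a : ℕ) (hn : 1 ≤ n) (h : Equiv.Perm (Fin n)) :
    (Finset.univ.filter (fun v : Fin n → Fin a => Tuple.sort v = h)).card =
      (n + a - 1 - des n h).choose n := by
  obtain ⟨m, rfl⟩ : ∃ m, n = m + 1 := ⟨n - 1, by omega⟩
  rw [← card_strictMono_fin]
  have hlast := desBefore_last m h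
  have hdes : des (m + 1) h ≤ m := hlast ▸ desBefore_le _ _ _
  have hle := desBefore_le (m + 1) h
  have hmono : ∀ k : Fin (m + 1), (k : ℕ) - desBefore (m + 1) h k ≤ m - des (m + 1) h := by
    intro k
    have := sub_desBefore_mono (m + 1) h (show (k : ℕ) ≤ m by have := k.2; omega)
    simpa [hlast] using this
  have hmono2 : ∀ k : Fin (m + 1), desBefore (m + 1) h k ≤ des (m + 1) h := by
    intro k
    have := desBefore_mono (m + 1) h (show (k : ℕ) ≤ m by have := k.2; omega)
    simpa [hlast] using this
  have hback : ∀ t : Fin (m + 1) → Fin (m + 1 + a - 1 - des (m + 1) h), StrictMono t →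
      ∀ k : Fin (m + 1), (k : ℕ) ≤ t k ∧ (t k : ℕ) - (k - desBefore (m + 1) h k) < a := by
    intro t ht k
    have h1 := strictMono_add_le ht 0 k (Fin.zero_le _)
    have h2 := strictMono_add_le ht k (Fin.last m) (Fin.le_last _)
    have h3 := (t (Fin.last m)).2
    have h4 := hmono2 k
    have h5 := k.2
    have h6 := hle k
    simp only [Fin.val_last, Fin.val_zero] at *
    omega
  refine Finset.card_bij'
    (fun v _ k => ⟨(v (h k) : ℕ) + (k - desBefore (m + 1) h k), ?_⟩)
    (fun t ht k => ⟨(t (h⁻¹ k) : ℕ) - ((h⁻¹ k : Fin (m + 1)) - desBefore (m + 1) h (h⁻¹ k : Fin (m + 1))),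
      (hback t (Finset.mem_filter.1 ht).2 (h⁻¹ k)).2⟩) ?_ ?_ ?_ ?_
  · have h1 := (v (h k)).2
    have h2 := hmono k
    omega
  · intro v hv
    have hv' := (sort_eq_iff_local m a h v).1 (Finset.mem_filter.1 hv).2
    simp only [Finset.mem_filter, Finset.mem_univ, true_and]
    rw [Fin.strictMono_iff_lt_succ]
    intro i
    have h1 := hv' i
    have h2 := desBefore_succ (m + 1) h i
    have h3 := hle i
    rw [Fin.mk_lt_mk]
    simp only [Fin.val_castSucc, Fin.val_succ]
    rw [h2]
    split_ifs at h1 ⊢ <;> omega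
  · intro t ht
    have ht' := (Finset.mem_filter.1 ht).2
    simp only [Finset.mem_filter, Finset.mem_univ, true_and]
    rw [sort_eq_iff_local]
    intro i
    have h1 : (t i.castSucc : ℕ) < t i.succ := ht' Fin.castSucc_lt_succ
    have h2 := desBefore_succ (m + 1) h i
    have h3 := hle i
    have h4 := (hback t ht' i.castSucc).1
    have h5 := (hback t ht' i.succ).1
    simp only [inv_self_app, Fin.val_castSucc, Fin.val_succ] at *
    rw [h2]
    split_ifs <;> omega
  · intro v hv
    funext k
    apply Fin.ext
    simp
  · intro t ht
    funext k
    apply Fin.ext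
    have h4 := (hback t (Finset.mem_filter.1 ht).2 k).1
    simp only [inv_self_app]
    omega

theorem sort_orderIso {n : ℕ} {α β : Type*} [LinearOrder α] [LinearOrder β] (e : α ≃o β)
    (v : Fin n → α) : Tuple.sort (e ∘ v) = Tuple.sort v := by
  symm
  have h := (Tuple.eq_sort_iff (f := v) (σ := Tuple.sort v)).1 rfl
  rw [Tuple.eq_sort_iff]
  refine ⟨?_, ?_⟩
  · exact e.monotone.comp h.1
  · intro i j hij he
    exact h.2 i j hij (e.injective he)

theorem sort_lex {n : ℕ} {α β : Type*} [LinearOrder α] [LinearOrder β]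
    (v : Fin n → α) (u : Fin n → β) :
    Tuple.sort (fun i => toLex (v ((Tuple.sort u)⁻¹ i), u i)) = Tuple.sort u * Tuple.sort v := by
  have hv := (eq_sort_iff_lex v _).1 rfl
  have hu := (eq_sort_iff_lex u _).1 rfl
  rw [eq_sort_iff_lex]
  intro i j hij
  have h1 := hv hij
  simp only [Prod.Lex.toLex_lt_toLex, Equiv.Perm.mul_apply, inv_self_app] at h1 ⊢
  rcases h1 with h1 | ⟨h1, h2⟩
  · left; left; exact h1
  · have h3 := hu h2
    simp only [Prod.Lex.toLex_lt_toLex] at h3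
    rcases h3 with h3 | ⟨h3, h4⟩
    · left; right; exact ⟨h1, h3⟩
    · right; refine ⟨?_, h4⟩
      rw [h1, h3]

/-- the radix-sort bijection on words -/
noncomputable def radixEquiv (n a b : ℕ) :
    (Fin n → Fin a) × (Fin n → Fin b) ≃ (Fin n → Fin a ×ₗ Fin b) where
  toFun p := fun i => toLex (p.1 ((Tuple.sort p.2)⁻¹ i), p.2 i)
  invFun w := (fun i => (ofLex (w (Tuple.sort (fun j => (ofLex (w j)).2) i))).1,
    fun j => (ofLex (w j)).2)
  left_inv p := by simp
  right_inv w := by simp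

theorem sum_sort_conv (n a b : ℕ) (π : Equiv.Perm (Fin n)) :
    ∑ g : Equiv.Perm (Fin n),
      (Finset.univ.filter (fun v : Fin n → Fin a => Tuple.sort v = g⁻¹ * π)).card *
      (Finset.univ.filter (fun u : Fin n → Fin b => Tuple.sort u = g)).card =
    (Finset.univ.filter (fun w : Fin n → Fin (a * b) => Tuple.sort w = π)).card := by
  let e : Fin a ×ₗ Fin b ≃o Fin (a * b) :=
    (Fintype.orderIsoFinOfCardEq (Fin a ×ₗ Fin b) (k := a * b) (by
      rw [← Fintype.card_congr (toLex (α := Fin a × Fin b))]; simp)).symm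
  have hR : (Finset.univ.filter (fun w : Fin n → Fin (a * b) => Tuple.sort w = π)).card =
      ∑ p : (Fin n → Fin a) × (Fin n → Fin b),
        if Tuple.sort p.2 * Tuple.sort p.1 = π then 1 else 0 := by
    rw [Finset.card_filter]
    symm
    refine Fintype.sum_equiv ((radixEquiv n a b).trans (Equiv.arrowCongr (Equiv.refl _) e.toEquiv))
      _ _ ?_
    intro p
    have : Tuple.sort (((radixEquiv n a b).trans
        (Equiv.arrowCongr (Equiv.refl _) e.toEquiv)) p) = Tuple.sort p.2 * Tuple.sort p.1 := by
      rw [← sort_lex]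
      exact sort_orderIso e _
    rw [this]
  rw [hR, Fintype.sum_prod_type_right]
  simp only [Finset.card_filter, Finset.mul_sum]
  rw [Finset.sum_comm]
  refine Finset.sum_congr rfl fun u _ => ?_
  simp [eq_inv_mul_iff_mul_eq]

theorem Pa_mul (n a b : ℕ) (hn : 1 ≤ n) : Pa n a * Pa n b = Pa n (a * b) := by
  ext σ τ
  have h := sum_sort_conv n a b (τ⁻¹ * σ)
  simp only [card_sort _ _ hn] at h
  rw [Matrix.mul_apply]
  simp only [Pa]
  rw [← h, Nat.cast_sum, Finset.sum_div]
  refine Fintype.sum_equiv (Equiv.mulLeft τ⁻¹) _ _ ?_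
  intro ρ
  simp [mul_assoc, mul_pow]
  field_simp

theorem Pa_pow (n a : ℕ) (hn : 1 ≤ n) (k : ℕ) : Pa n a ^ (k + 1) = Pa n (a ^ (k + 1)) := by
  induction k with
  | zero => simp
  | succ k ih => rw [pow_succ, ih, Pa_mul n _ _ hn, pow_succ a (k + 1)]

/-! ### The cycle generating function -/

theorem card_quot_sameCycle (n : ℕ) (σ : Equiv.Perm (Fin n)) :
    Nat.card (Quotient (Equiv.Perm.SameCycle.setoid σ)) = cyclesCount n σ := by
  classical
  obtain ⟨b⟩ := Equiv.Perm.Basis.nonempty σ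
  let f : Function.fixedPoints σ ⊕ σ.cycleFactorsFinset →
      Quotient (Equiv.Perm.SameCycle.setoid σ) :=
    Sum.elim (fun x => Quotient.mk _ (x : Fin n)) (fun c => Quotient.mk _ (b c))
  have hnf : ∀ c, b c ∉ Function.fixedPoints σ := by
    intro c hc
    have h1 := b.mem_support_self c
    have h2 := Equiv.Perm.mem_cycleFactorsFinset_support_le c.2 h1
    exact (Equiv.Perm.mem_support.1 h2) hc
  have hf : Function.Bijective f := by
    constructor
    · rintro (⟨x, hx⟩ | c) (⟨y, hy⟩ | d) h
      · have h' : σ.SameCycle x y := Quotient.exact h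
        have := h'.eq_of_left hx
        subst this; rfl
      · have h' : σ.SameCycle x (b d) := Quotient.exact h
        have := h'.eq_of_left hx
        subst this
        exact absurd hx (hnf d)
      · have h' : σ.SameCycle (b c) y := Quotient.exact h
        have := h'.symm.eq_of_left hy
        subst this
        exact absurd hy (hnf c)
      · have h' : σ.SameCycle (b c) (b d) := Quotient.exact h
        have h2 := h'.cycleOf_eq
        rw [b.cycleOf_eq, b.cycleOf_eq] at h2
        rw [Subtype.ext h2]
    · intro q
      induction q using Quotient.inductionOn with
      | h x =>
        rcases b.mem_fixedPoints_or_exists_zpow_eq x with h | ⟨c, _, k, hk⟩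
        · exact ⟨Sum.inl ⟨x, h⟩, rfl⟩
        · exact ⟨Sum.inr c, Quotient.sound ⟨k, hk⟩⟩
  rw [← Nat.card_congr (Equiv.ofBijective f hf), Nat.card_sum]
  have h1 : Nat.card (σ.cycleFactorsFinset) = σ.cycleType.card := by
    simp [Equiv.Perm.cycleType_def]
  have h2 : Nat.card (Function.fixedPoints σ) = n - σ.support.card := by
    rw [Nat.card_eq_fintype_card, Equiv.Perm.card_fixedPoints, Equiv.Perm.sum_cycleType]
    simp
  rw [h1, h2, cyclesCount, add_comm]

theorem card_fixed_words (n a : ℕ) (σ : Equiv.Perm (Fin n)) :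
    (Finset.univ.filter (fun w : Fin n → Fin a => w ∘ σ = w)).card = a ^ cyclesCount n σ := by
  classical
  rw [← card_quot_sameCycle]
  have e : {w : Fin n → Fin a // w ∘ σ = w} ≃
      (Quotient (Equiv.Perm.SameCycle.setoid σ) → Fin a) :=
    { toFun := fun w q => Quotient.lift w.1 (by
        rintro x y ⟨k, rfl⟩
        have hw : ∀ x, w.1 (σ x) = w.1 x := fun x => congrFun w.2 x
        have hz : ∀ (k : ℤ) x, w.1 ((σ ^ k) x) = w.1 x := by
          intro k
          induction k using Int.induction_on with
          | zero => simp
          | succ k ih => intro x; rw [zpow_add, zpow_one, Equiv.Perm.mul_apply, ih, hw]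
          | pred k ih =>
            intro x
            rw [zpow_sub, zpow_one, Equiv.Perm.mul_apply, ih, ← hw]; simp
        exact (hz k x).symm) q
      invFun := fun f => ⟨fun x => f (Quotient.mk _ x), by
        funext x
        have : (Quotient.mk (Equiv.Perm.SameCycle.setoid σ) (σ x)) = Quotient.mk _ x :=
          Quotient.sound (show σ.SameCycle (σ x) x from
            (Equiv.Perm.sameCycle_apply_left).2 (Equiv.Perm.SameCycle.refl _ _))
        simp [this]⟩
      left_inv := fun w => rfl
      right_inv := fun f => by
        funext q
        induction q using Quotient.inductionOn with
        | h x => rfl }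
  rw [← Fintype.card_subtype, ← Nat.card_eq_fintype_card, Nat.card_congr e, Nat.card_fun]
  simp

theorem des_one (n : ℕ) : des n 1 = 0 := by
  unfold des desSet
  rw [Finset.card_eq_zero, Finset.filter_eq_empty_iff]
  rintro i _ ⟨h, h2⟩
  simp at h2

theorem sum_pow_cycles (n a : ℕ) (hn : 1 ≤ n) :
    ∑ σ : Equiv.Perm (Fin n), a ^ cyclesCount n σ =
      Fintype.card (Equiv.Perm (Fin n)) * (n + a - 1 - des n 1).choose n := by
  rw [← card_sort n a hn]
  have : Fintype.card (Equiv.Perm (Fin n)) *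
      (Finset.univ.filter (fun v : Fin n → Fin a => Tuple.sort v = 1)).card =
      ∑ p : Equiv.Perm (Fin n) × (Fin n → Fin a), if Tuple.sort p.2 = 1 then 1 else 0 := by
    rw [Fintype.sum_prod_type, Finset.card_filter]
    simp
  rw [this]
  simp only [← card_fixed_words, Finset.card_filter]
  rw [← Fintype.sum_prod_type' (f := fun (σ : Equiv.Perm (Fin n)) (w : Fin n → Fin a) =>
    if w ∘ σ = w then 1 else 0), ← Finset.card_filter, ← Finset.card_filter]
  refine Finset.card_bij' (fun p _ => (p.1 * Tuple.sort p.2, p.2 ∘ Tuple.sort p.2))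
    (fun q _ => (q.1 * (Tuple.sort (q.2 ∘ (q.1⁻¹ : Equiv.Perm (Fin n))))⁻¹,
      q.2 ∘ (q.1⁻¹ : Equiv.Perm (Fin n)))) ?_ ?_ ?_ ?_
  · rintro ⟨σ, w⟩ _
    simp only [Finset.mem_filter, Finset.mem_univ, true_and]
    exact Tuple.sort_eq_refl_iff_monotone.2 (Tuple.monotone_sort w)
  · rintro ⟨τ, s⟩ hs
    simp only [Finset.mem_filter, Finset.mem_univ, true_and] at hs ⊢
    have hmono : Monotone s := Tuple.sort_eq_refl_iff_monotone.1 hs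
    have h1 : (s ∘ (τ⁻¹ : Equiv.Perm (Fin n))) ∘ τ = s := by funext x; simp
    have h2 := (Tuple.comp_sort_eq_comp_iff_monotone (f := s ∘ (τ⁻¹ : Equiv.Perm (Fin n)))
      (σ := τ)).2 (by rw [h1]; exact hmono)
    rw [h1] at h2
    funext x
    have h3 := congrFun h2 ((Tuple.sort (s ∘ (τ⁻¹ : Equiv.Perm (Fin n))))⁻¹ x)
    simpa using h3
  · rintro ⟨σ, w⟩ hw
    simp only [Finset.mem_filter, Finset.mem_univ, true_and] at hw
    have h1 : (w ∘ Tuple.sort w) ∘ ((σ * Tuple.sort w)⁻¹ : Equiv.Perm (Fin n)) = w := by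
      funext x
      have := congrFun hw (σ⁻¹ x)
      simp at this
      simp [this]
    simp only [h1]
    simp
  · rintro ⟨τ, s⟩ hs
    simp only [Finset.mem_filter, Finset.mem_univ, true_and] at hs
    have hmono : Monotone s := Tuple.sort_eq_refl_iff_monotone.1 hs
    have h1 : (s ∘ (τ⁻¹ : Equiv.Perm (Fin n))) ∘ τ = s := by funext x; simp
    have h2 := (Tuple.comp_sort_eq_comp_iff_monotone (f := s ∘ (τ⁻¹ : Equiv.Perm (Fin n)))
      (σ := τ)).2 (by rw [h1]; exact hmono)
    rw [h1] at h2
    simp only [← h2]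
    simp

/-- The characteristic polynomial of the `a`-handed riffle shuffle transition matrix
is `∏_{σ ∈ S_n} (X - a^{c(σ) - n})`, where `c(σ)` is the number of cycles of `σ`. -/
theorem stmt3 (n a : ℕ) (hn : 1 ≤ n) (ha : 1 ≤ a) :
    (Pa n a).charpoly =
      ∏ σ : Equiv.Perm (Fin n),
        (Polynomial.X - Polynomial.C ((a : ℚ) ^ ((cyclesCount n σ : ℤ) - (n : ℤ)))) := by
  apply charpoly_eq_of_trace_pow
  intro k
  rcases k with _ | k
  · simp
  · rw [Pa_pow n a hn]
    have ha0 : (a : ℚ) ≠ 0 := by exact_mod_cast (by omega : a ≠ 0)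
    have h := sum_pow_cycles n (a ^ (k + 1)) hn
    have h' : ∑ σ : Equiv.Perm (Fin n), ((a : ℚ) ^ (k + 1)) ^ cyclesCount n σ =
      Fintype.card (Equiv.Perm (Fin n)) *
        ((n + a ^ (k + 1) - 1 - des n 1).choose n : ℚ) := by exact_mod_cast h
    have hL : (Pa n (a ^ (k + 1))).trace = (Fintype.card (Equiv.Perm (Fin n)) *
        ((n + a ^ (k + 1) - 1 - des n 1).choose n : ℚ)) / ((a : ℚ) ^ (k + 1)) ^ n := by
      simp only [Matrix.trace, Matrix.diag, Pa, inv_mul_cancel, Finset.sum_const,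
        Finset.card_univ, nsmul_eq_mul]
      push_cast
      ring
    rw [hL, ← h', Finset.sum_div]
    refine Finset.sum_congr rfl fun σ _ => ?_
    rw [zpow_sub₀ ha0, zpow_natCast, zpow_natCast, div_pow, ← pow_mul, ← pow_mul, ← pow_mul,
      ← pow_mul, mul_comm, mul_comm (k + 1) n]
end

section
/- For every integer n ≥ 1, the characteristic polynomial of the top-to-random transition matrix P on S_n (a matrix over ℚ indexed by S_n) equals ∏_{j=0}^{n} (X − j/n)^{f_j}, where f_j is the number of permutations in S_n with exactly j fixed points. In particular the eigenvalues of the top-to-random shuffle are 0, 1/n, 2/n, …, (n−2)/n, 1, and (n−1)/n is not an eigenvalue. -/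
open Finset

/-- top-to-random transition matrix over ℚ: remove the top card and reinsert it
at a uniformly random position. (`Fin.cycleRange i` is the cycle `c_i`, 0-indexed:
it sends `j ↦ j+1` for `j < i`, `i ↦ 0`, and fixes `j > i`.) -/
def Pttr (n : ℕ) : Matrix (Equiv.Perm (Fin n)) (Equiv.Perm (Fin n)) ℚ :=
  fun σ τ => ((Finset.univ.filter (fun i : Fin n => τ = σ * Fin.cycleRange i)).card : ℚ) / n

/-- number of fixed points of a permutation -/
def fixedPointCount (n : ℕ) (σ : Equiv.Perm (Fin n)) : ℕ :=
  (Finset.univ.filter (fun x => σ x = x)).card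

theorem gen {m : Type*} [Fintype m] [DecidableEq m] (A : Matrix m m ℚ) (c : ℚ) (e : m → ℚ)
   (s : Finset ℚ) (hs : Polynomial.aeval A (∏ j ∈ s, (Polynomial.X - Polynomial.C j)) = 0)
   (ht : ∀ p : Polynomial ℚ, (Polynomial.aeval A p).trace = ∑ i, p.eval (e i)) :
   (c • A).charpoly = ∏ i, (Polynomial.X - Polynomial.C (c * e i)) := by
  classical
  set f : Module.End ℚ (m → ℚ) := Matrix.toLinAlgEquiv' A with hf
  have hfp : ∀ p : Polynomial ℚ, Polynomial.aeval f p = Matrix.toLinAlgEquiv' (Polynomial.aeval A p) := by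
    intro p
    rw [hf]
    exact Polynomial.aeval_algHom_apply (Matrix.toLinAlgEquiv' : Matrix m m ℚ ≃ₐ[ℚ] _).toAlgHom A p
  let S : Set (m → ℚ) := {v | ∃ μ : ℚ, f v = μ • v}
  have hspan : ⊤ ≤ Submodule.span ℚ S := by
    intro v _
    by_cases hne : s.Nonempty
    · have h1 := Lagrange.sum_basis (v := (id : ℚ → ℚ)) (s := s) (Set.injOn_id _) hne
      have h2 : v = ∑ j ∈ s, Polynomial.aeval f (Lagrange.basis s id j) v := by
        have := congrArg (fun p => Polynomial.aeval f p v) h1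
        simpa [LinearMap.sum_apply] using this.symm
      rw [h2]
      refine Submodule.sum_mem _ fun j hj => Submodule.subset_span ⟨j, ?_⟩
      have h3 : Polynomial.aeval f ((Polynomial.X - Polynomial.C j) * Lagrange.basis s id j) = 0 := by
        have : (Polynomial.X - Polynomial.C j) * Lagrange.basis s id j =
          Polynomial.C (∏ k ∈ s.erase j, (j - k)⁻¹) * ∏ j ∈ s, (Polynomial.X - Polynomial.C j) := by
          rw [← Finset.mul_prod_erase s _ hj]
          simp only [Lagrange.basis, Lagrange.basisDivisor, Finset.prod_mul_distrib, map_prod, id]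
          ring
        rw [this, map_mul, hfp (∏ j ∈ s, _), hs]; simp
      have h4 := congrArg (fun g => g v) h3
      simpa [sub_eq_zero] using h4
    · rw [Finset.not_nonempty_iff_eq_empty] at hne
      subst hne
      have h5 := hfp 1
      simp at hs h5
      have : (1 : Module.End ℚ (m → ℚ)) v = 0 := by rw [← map_one (Matrix.toLinAlgEquiv' : Matrix m m ℚ ≃ₐ[ℚ] _), hs]; simp
      simp at this
      rw [this]; simp
  let b0 := Module.Basis.ofSpan hspan
  let b := b0.reindex (b0.indexEquiv (Module.finBasis ℚ (m → ℚ)))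
  have hb : ∀ i, ∃ μ : ℚ, f (b i) = μ • b i := by
    intro i
    apply Module.Basis.ofSpan_subset hspan
    simp only [b, Module.Basis.reindex_apply]
    exact ⟨_, rfl⟩
  choose d hd using hb
  have hpd : ∀ p : Polynomial ℚ, ∀ i, Polynomial.aeval f p (b i) = (p.eval (d i)) • b i := by
    intro p i
    induction p using Polynomial.induction_on' with
    | add p q hp hq => simp [hp, hq, add_smul]
    | monomial k a =>
      have : ∀ k : ℕ, (f ^ k) (b i) = (d i ^ k) • b i := by
        intro k
        induction k with
        | zero => simp
        | succ k ih => rw [pow_succ', Module.End.mul_apply, ih, map_smul, hd, smul_smul, pow_succ]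
      simp [Polynomial.aeval_monomial, this, smul_smul, mul_comm]
  have hdiag : ∀ p : Polynomial ℚ, LinearMap.toMatrix b b (Polynomial.aeval f p) =
      Matrix.diagonal (fun i => p.eval (d i)) := by
    intro p
    ext i j
    rw [LinearMap.toMatrix_apply, hpd]
    by_cases h : i = j
    · subst h; simp
    · simp [h]
  have htr : ∀ p : Polynomial ℚ, ∑ i, p.eval (d i) = ∑ i, p.eval (e i) := by
    intro p
    rw [← ht p, ← Matrix.trace_toLin'_eq, LinearMap.trace_eq_matrix_trace ℚ b]
    have := hdiag p
    rw [hfp] at this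
    change LinearMap.toMatrix b b (Matrix.toLin' _) = _ at this
    rw [this, Matrix.trace_diagonal]
  have hcount : ∀ μ : ℚ, (univ.filter fun i => d i = μ).card = (univ.filter fun i => e i = μ).card := by
    intro μ
    let T : Finset ℚ := insert μ (univ.image d ∪ univ.image e)
    have hev : ∀ x ∈ T, (Lagrange.basis T id μ).eval x = if x = μ then 1 else 0 := by
      intro x hx
      by_cases h : x = μ
      · subst h
        simpa using Lagrange.eval_basis_self (v := (id : ℚ → ℚ)) (Set.injOn_id _) hx
      · simpa [h] using Lagrange.eval_basis_of_ne (v := (id : ℚ → ℚ)) (Ne.symm h) hx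
    have h := htr (Lagrange.basis T id μ)
    rw [Finset.sum_congr rfl (fun i _ => hev (d i) (by simp [T])),
      Finset.sum_congr rfl (fun i _ => hev (e i) (by simp [T]))] at h
    simp only [Finset.sum_boole] at h
    exact_mod_cast h
  have hmul : (univ.val.map d) = (univ.val.map e) := by
    ext μ
    rw [Multiset.count_map, Multiset.count_map]
    have := hcount μ
    simpa [Finset.card, Finset.filter, eq_comm] using this
  have hch : (c • A).charpoly = ∏ i, (Polynomial.X - Polynomial.C (c * d i)) := by
    rw [← Matrix.charpoly_toLin', ← LinearMap.charpoly_toMatrix _ b]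
    have := hdiag (Polynomial.C c * Polynomial.X)
    rw [hfp] at this
    change LinearMap.toMatrix b b (Matrix.toLin' _) = _ at this
    simp only [map_mul, Polynomial.aeval_C, Polynomial.aeval_X, Polynomial.eval_mul, Polynomial.eval_C,
      Polynomial.eval_X, ← Algebra.smul_def] at this
    rw [this, Matrix.charpoly_diagonal]
  rw [hch]
  have := congrArg (fun M => (M.map (fun x : ℚ => Polynomial.X - Polynomial.C (c * x))).prod) hmul
  simp only [Multiset.map_map] at this
  exact this

theorem sumDesc (n a : ℕ) : ∑ σ : Equiv.Perm (Fin n), (fixedPointCount n σ).descFactorial a =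
    if a ≤ n then n.factorial else 0 := by
  classical
  have h := MulAction.sum_card_fixedBy_eq_card_orbits_mul_card_group (Equiv.Perm (Fin n)) (Fin a ↪ Fin n)
  have hs : Subsingleton (MulAction.orbitRel.Quotient (Equiv.Perm (Fin n)) (Fin a ↪ Fin n)) := by
    rw [← MulAction.pretransitive_iff_subsingleton_quotient]
    exact Equiv.Perm.isMultiplyPretransitive _ _
  have hq : Fintype.card (Quotient (MulAction.orbitRel (Equiv.Perm (Fin n)) (Fin a ↪ Fin n))) =
      if a ≤ n then 1 else 0 := by
    split_ifs with ha
    · have : Nonempty (MulAction.orbitRel.Quotient (Equiv.Perm (Fin n)) (Fin a ↪ Fin n)) :=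
        ⟨Quotient.mk _ (Fin.castLEEmb ha)⟩
      apply le_antisymm
      · exact Fintype.card_le_one_iff_subsingleton.mpr hs
      · exact Fintype.card_pos_iff.mpr this
    · rw [Fintype.card_eq_zero_iff]
      refine ⟨fun x => ?_⟩
      induction x using Quotient.inductionOn with
      | h x => exact ha (by simpa using Fintype.card_le_of_embedding x)
  rw [hq, Fintype.card_perm, Fintype.card_fin] at h
  have hf : ∀ σ : Equiv.Perm (Fin n), Fintype.card (MulAction.fixedBy (Fin a ↪ Fin n) σ) =
      (fixedPointCount n σ).descFactorial a := by
    intro σ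
    have e : MulAction.fixedBy (Fin a ↪ Fin n) σ ≃ (Fin a ↪ {x : Fin n // σ x = x}) :=
      { toFun := fun x => ⟨fun i => ⟨x.1 i, by
            have := x.2
            rw [MulAction.mem_fixedBy] at this
            exact congrArg (fun y : Fin a ↪ Fin n => y i) this⟩, fun i j hij => by
            exact x.1.injective (Subtype.ext_iff.1 hij)⟩
        invFun := fun y => ⟨y.trans (Function.Embedding.subtype _), by
            rw [MulAction.mem_fixedBy]
            ext i
            simp [Function.Embedding.smul_apply, (y i).2]⟩
        left_inv := fun x => by ext; rfl
        right_inv := fun y => by ext; rfl }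
    rw [Fintype.card_congr e, Fintype.card_embedding_eq, Fintype.card_fin, Fintype.card_subtype]
    rfl
  simp only [hf] at h
  rw [h]; split_ifs <;> simp

/-- The set of `u` increasing on positions `≥ a`. -/
def TT (n a : ℕ) (u : Equiv.Perm (Fin n)) : Prop :=
  a ≤ n ∧ ∀ i j : Fin n, a ≤ i.val → i < j → u i < u j

theorem cyc_of_ge {n a : ℕ} (u : Equiv.Perm (Fin (n+1))) (ha : a ≤ n) (i : Fin (n+1)) (hi : a ≤ i.val) :
    TT (n+1) a (u * Fin.cycleRange i) ↔ TT (n+1) (a+1) u ∧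
      (∀ j : Fin (n+1), a < j.val → j ≤ i → u j < u 0) ∧ ∀ j : Fin (n+1), i < j → u 0 < u j := by
  have hlt : ∀ j : Fin (n+1), ∀ h : j < i, Fin.cycleRange i j = ⟨j.val + 1, by omega⟩ := by
    intro j h
    ext
    exact Fin.coe_cycleRange_of_lt h
  constructor
  · rintro ⟨-, h⟩
    have h1 : ∀ j : Fin (n+1), a < j.val → j ≤ i → u j < u 0 := by
      intro j hj hji
      have := h ⟨j.val - 1, by omega⟩ i (by simp; omega) (by simp only [Fin.lt_def, Fin.le_def] at *; omega)
      rw [Equiv.Perm.mul_apply, Equiv.Perm.mul_apply, hlt _ (by simp only [Fin.lt_def, Fin.le_def] at *; omega),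
        Fin.cycleRange_self] at this
      convert this
      simp; omega
    have h2 : ∀ j : Fin (n+1), i < j → u 0 < u j := by
      intro j hj
      have := h i j hi hj
      rwa [Equiv.Perm.mul_apply, Equiv.Perm.mul_apply, Fin.cycleRange_self, Fin.cycleRange_of_gt hj] at this
    refine ⟨⟨by omega, ?_⟩, h1, h2⟩
    intro j k hj hjk
    rcases le_or_gt k i with hk | hk
    · have := h ⟨j.val - 1, by omega⟩ ⟨k.val - 1, by omega⟩ (by simp; omega) (by simp only [Fin.lt_def, Fin.le_def] at *; omega)
      rw [Equiv.Perm.mul_apply, Equiv.Perm.mul_apply, hlt _ (by simp only [Fin.lt_def, Fin.le_def] at *; omega),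
        hlt _ (by simp only [Fin.lt_def, Fin.le_def] at *; omega)] at this
      convert this <;> simp only [Fin.lt_def, Fin.le_def] at * <;> omega
    · rcases le_or_gt j i with hj' | hj'
      · exact (h1 j (by omega) hj').trans (h2 k hk)
      · have := h j k (by omega) hjk
        rwa [Equiv.Perm.mul_apply, Equiv.Perm.mul_apply, Fin.cycleRange_of_gt hk, Fin.cycleRange_of_gt hj'] at this
  · rintro ⟨⟨-, h⟩, h1, h2⟩
    refine ⟨by omega, ?_⟩
    intro j k hj hjk
    rw [Equiv.Perm.mul_apply, Equiv.Perm.mul_apply]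
    rcases lt_trichotomy k i with hk | hk | hk
    · rw [hlt k hk, hlt j (hjk.trans hk)]
      exact h _ _ (by simp; omega) (by simp only [Fin.lt_def] at *; omega)
    · subst hk
      rw [hlt j hjk, Fin.cycleRange_self]
      exact h1 _ (by simp; omega) (by simp only [Fin.lt_def, Fin.le_def] at *; omega)
    · rw [Fin.cycleRange_of_gt hk]
      rcases lt_trichotomy j i with hj' | hj' | hj'
      · rw [hlt j hj']
        exact h _ _ (by simp; omega) (by simp only [Fin.lt_def] at *; omega)
      · subst hj'
        rw [Fin.cycleRange_self]; exact h2 _ hk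
      · rw [Fin.cycleRange_of_gt hj']
        exact h _ _ (by simp only [Fin.lt_def] at *; omega) hjk

theorem cyc_of_lt {n a : ℕ} (u : Equiv.Perm (Fin (n+1))) (i : Fin (n+1)) (hi : i.val < a) :
    TT (n+1) a (u * Fin.cycleRange i) ↔ TT (n+1) a u := by
  unfold TT
  refine and_congr_right fun _ => forall_congr' fun j => forall_congr' fun k => ?_
  refine imp_congr_right fun hj => imp_congr_right fun hjk => ?_
  have h1 : i < j := by simp only [Fin.lt_def] at *; omega
  rw [Equiv.Perm.mul_apply, Equiv.Perm.mul_apply, Fin.cycleRange_of_gt h1, Fin.cycleRange_of_gt (h1.trans hjk)]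

open Classical in
theorem ge_count {n a : ℕ} (u : Equiv.Perm (Fin (n+1))) (ha : a ≤ n) :
    (univ.filter (fun i : Fin (n+1) => a ≤ i.val ∧ TT (n+1) a (u * Fin.cycleRange i))).card =
      if TT (n+1) (a+1) u then 1 else 0 := by
  split_ifs with hu
  · rw [Finset.card_eq_one]
    let F : Finset (Fin (n+1)) := insert ⟨a, by omega⟩ (univ.filter fun j => a < j.val ∧ u j < u 0)
    have hF : F.Nonempty := ⟨_, Finset.mem_insert_self _ _⟩
    let i := F.max' hF
    have hiF : i ∈ F := F.max'_mem hF
    have hia : a ≤ i.val := by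
      simp only [F, Finset.mem_insert, Finset.mem_filter, Finset.mem_univ, true_and] at hiF
      rcases hiF with h | h
      · rw [h]
      · exact h.1.le
    refine ⟨i, ?_⟩
    ext k
    simp only [Finset.mem_filter, Finset.mem_univ, true_and, Finset.mem_singleton]
    have hi1 : ∀ j : Fin (n+1), a < j.val → j ≤ i → u j < u 0 := by
      intro j hj hji
      simp only [F, Finset.mem_insert, Finset.mem_filter, Finset.mem_univ, true_and] at hiF
      rcases hiF with h | h
      · rw [h, Fin.le_def] at hji; simp at hji; omega
      · rcases hji.eq_or_lt with h' | h'
        · rw [h']; exact h.2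
        · exact (hu.2 j i hj h').trans h.2
    have hi2 : ∀ j : Fin (n+1), i < j → u 0 < u j := by
      intro j hj
      by_contra hcon
      have hne : u j ≠ u 0 := by
        intro h
        have := u.injective h
        rw [this] at hj
        simp [Fin.lt_def] at hj
      have hlt : u j < u 0 := lt_of_le_of_ne (not_lt.mp hcon) hne
      have : j ∈ F := by
        simp only [F, Finset.mem_insert, Finset.mem_filter, Finset.mem_univ, true_and]
        right
        exact ⟨lt_of_le_of_lt hia hj, hlt⟩
      exact absurd (F.le_max' j this) (not_le.mpr hj)
    constructor
    · rintro ⟨hk, h⟩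
      rw [cyc_of_ge u ha k hk] at h
      rcases lt_trichotomy k i with h' | h' | h'
      · exact absurd (h.2.2 i h') (not_lt.mpr (hi1 i (lt_of_le_of_lt hk h') le_rfl).le)
      · exact h'
      · exact absurd (hi2 k h') (not_lt.mpr (h.2.1 k (lt_of_le_of_lt hia h') le_rfl).le)
    · rintro rfl
      exact ⟨hia, (cyc_of_ge u ha _ hia).2 ⟨hu, hi1, hi2⟩⟩
  · rw [Finset.card_eq_zero, Finset.filter_eq_empty_iff]
    rintro i - ⟨hi, h⟩
    exact hu ((cyc_of_ge u ha i hi).1 h).1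

open Classical in
theorem count_all {n : ℕ} (a : ℕ) (u : Equiv.Perm (Fin (n+1))) :
    (univ.filter (fun i : Fin (n+1) => TT (n+1) a (u * Fin.cycleRange i))).card =
      a * (if TT (n+1) a u then 1 else 0) + if TT (n+1) (a+1) u then 1 else 0 := by
  rcases lt_or_ge (n+1) a with ha | ha
  · have h1 : ∀ v, ¬ TT (n+1) a v := fun v h => absurd h.1 (by omega)
    have h2 : ∀ v, ¬ TT (n+1) (a+1) v := fun v h => absurd h.1 (by omega)
    simp [h1, h2]
  have hlow : (univ.filter (fun i : Fin (n+1) => i.val < a ∧ TT (n+1) a (u * Fin.cycleRange i))).card =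
      a * (if TT (n+1) a u then 1 else 0) := by
    have : (univ.filter (fun i : Fin (n+1) => i.val < a ∧ TT (n+1) a (u * Fin.cycleRange i))) =
      univ.filter (fun i : Fin (n+1) => i.val < a ∧ TT (n+1) a u) := by
      ext i
      simp only [Finset.mem_filter, Finset.mem_univ, true_and]
      exact and_congr_right fun hi => cyc_of_lt u i hi
    rw [this]
    split_ifs with h
    · simp only [h, and_true, mul_one]
      rw [Fin.card_filter_val_lt]
      omega
    · simp [h]
  have hhigh : (univ.filter (fun i : Fin (n+1) => a ≤ i.val ∧ TT (n+1) a (u * Fin.cycleRange i))).card =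
      if TT (n+1) (a+1) u then 1 else 0 := by
    rcases ha.lt_or_eq with ha' | ha'
    · exact ge_count u (by omega)
    · have h2 : ∀ v, ¬ TT (n+1) (a+1) v := fun v h => absurd h.1 (by omega)
      simp only [h2, if_false, Finset.card_eq_zero, Finset.filter_eq_empty_iff]
      intro i _ h
      have := i.2
      omega
  rw [← hlow, ← hhigh, ← Finset.card_union_of_disjoint]
  · congr 1
    ext i
    simp only [Finset.mem_filter, Finset.mem_univ, true_and, Finset.mem_union]
    have := lt_or_ge i.val a
    tauto
  · rw [Finset.disjoint_filter]
    rintro i - h h'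
    omega

/-- Unnormalised transition matrix. -/
def MM (n : ℕ) : Matrix (Equiv.Perm (Fin n)) (Equiv.Perm (Fin n)) ℚ :=
  fun σ τ => ((Finset.univ.filter (fun i : Fin n => τ = σ * Fin.cycleRange i)).card : ℚ)

open Classical in
/-- `a` top cards to random. -/
noncomputable def BB (n a : ℕ) : Matrix (Equiv.Perm (Fin n)) (Equiv.Perm (Fin n)) ℚ :=
  fun σ τ => if TT n a (τ⁻¹ * σ) then 1 else 0

theorem MM_mul (n a : ℕ) : MM (n+1) * BB (n+1) a = (a : ℚ) • BB (n+1) a + BB (n+1) (a+1) := by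
  classical
  ext σ τ
  rw [Matrix.mul_apply]
  have h := count_all a (τ⁻¹ * σ)
  have h' : ∑ ρ, MM (n+1) σ ρ * BB (n+1) a ρ τ =
      ((univ.filter (fun i : Fin (n+1) => TT (n+1) a (τ⁻¹ * σ * Fin.cycleRange i))).card : ℚ) := by
    simp only [MM, Finset.card_filter, Nat.cast_sum, Finset.sum_mul]
    rw [Finset.sum_comm]
    refine Finset.sum_congr rfl fun i _ => ?_
    rw [Finset.sum_eq_single (σ * Fin.cycleRange i)]
    · simp [BB, mul_assoc]
    · intro ρ _ hρ; simp [hρ]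
    · simp
  rw [h', h]
  simp [BB]

theorem BB_zero (n : ℕ) : BB n 0 = 1 := by
  classical
  ext σ τ
  simp only [BB, Matrix.one_apply]
  congr 1
  apply propext
  constructor
  · rintro ⟨-, h⟩
    have hm : StrictMono (τ⁻¹ * σ) := fun i j hij => h i j (Nat.zero_le _) hij
    have h2 : τ⁻¹ * σ = 1 := by
      ext i
      have := congrFun (Subsingleton.elim
        (hm.orderIsoOfSurjective _ (τ⁻¹ * σ).surjective) (OrderIso.refl (Fin n)) |> congrArg DFunLike.coe) i
      simpa using congrArg Fin.val this
    exact (inv_mul_eq_one.1 h2).symm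
  · rintro rfl
    refine ⟨Nat.zero_le _, fun i j _ h => ?_⟩
    simpa using h

theorem aeval_desc (n a : ℕ) : Polynomial.aeval (MM (n+1)) (descPochhammer ℚ a) = BB (n+1) a := by
  induction a with
  | zero => simp [BB_zero]
  | succ a ih =>
    rw [descPochhammer_succ_right, mul_comm, map_mul, ih, map_sub, Polynomial.aeval_X, sub_mul, MM_mul]
    simp [← nsmul_eq_mul, ← Nat.cast_smul_eq_nsmul ℚ]

theorem trace_BB (n a : ℕ) : (BB n a).trace = if a ≤ n then (n.factorial : ℚ) else 0 := by
  classical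
  have : ∀ σ : Equiv.Perm (Fin n), BB n a σ σ = if a ≤ n then 1 else 0 := by
    intro σ
    simp only [BB]
    congr 1
    apply propext
    simp only [inv_mul_cancel]
    exact ⟨fun h => h.1, fun h => ⟨h, fun i j _ hij => hij⟩⟩
  simp only [Matrix.trace, Matrix.diag, this]
  split_ifs <;> simp [Fintype.card_perm]

theorem trace_aeval (n : ℕ) (p : Polynomial ℚ) : (Polynomial.aeval (MM (n+1)) p).trace =
    ∑ σ, p.eval (fixedPointCount (n+1) σ : ℚ) := by
  have key : ∀ a, (Polynomial.aeval (MM (n+1)) (descPochhammer ℚ a)).trace =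
    ∑ σ, (descPochhammer ℚ a).eval (fixedPointCount (n+1) σ : ℚ) := by
    intro a
    rw [aeval_desc, trace_BB]
    simp only [descPochhammer_eval_eq_descFactorial]
    have := sumDesc (n+1) a
    rw [← Nat.cast_sum, this]
    split_ifs <;> simp
  have key2 : ∀ k a, (Polynomial.aeval (MM (n+1)) (Polynomial.X ^ k * descPochhammer ℚ a)).trace =
    ∑ σ, (Polynomial.X ^ k * descPochhammer ℚ a).eval (fixedPointCount (n+1) σ : ℚ) := by
    intro k
    induction k with
    | zero => simpa using key
    | succ k ih =>
      intro a
      have : (Polynomial.X ^ (k+1) * descPochhammer ℚ a : Polynomial ℚ) =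
        Polynomial.X ^ k * descPochhammer ℚ (a+1) + Polynomial.C (a : ℚ) * (Polynomial.X ^ k * descPochhammer ℚ a) := by
        rw [descPochhammer_succ_right, Polynomial.C_eq_natCast]; ring
      rw [this, map_add, Matrix.trace_add, ih, map_mul, Polynomial.aeval_C, ← Algebra.smul_def, Matrix.trace_smul, ih]
      simp only [Polynomial.eval_add, Polynomial.eval_mul, Polynomial.eval_C, Finset.sum_add_distrib, Finset.mul_sum, smul_eq_mul]
  induction p using Polynomial.induction_on' with
  | add p q hp hq => simp [hp, hq, Finset.sum_add_distrib]
  | monomial k c =>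
    have := key2 k 0
    rw [← Polynomial.C_mul_X_pow_eq_monomial, map_mul, Polynomial.aeval_C, ← Algebra.smul_def, Matrix.trace_smul]
    simp only [descPochhammer_zero, mul_one] at this
    rw [this]
    simp [Finset.mul_sum]

theorem desc_prod (a : ℕ) : descPochhammer ℚ a =
    ∏ j ∈ (Finset.range a).image (fun j : ℕ => (j : ℚ)), (Polynomial.X - Polynomial.C j) := by
  rw [Finset.prod_image (fun _ _ _ _ h => by exact_mod_cast h)]
  induction a with
  | zero => simp
  | succ a ih => rw [descPochhammer_succ_right, Finset.prod_range_succ, ih]; simp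

theorem charpoly_main (n : ℕ) : (Pttr (n+1)).charpoly =
    ∏ σ, (Polynomial.X - Polynomial.C (((n+1 : ℕ) : ℚ)⁻¹ * fixedPointCount (n+1) σ)) := by
  have h : Pttr (n+1) = ((n+1 : ℕ) : ℚ)⁻¹ • MM (n+1) := by
    ext σ τ
    simp only [Pttr, MM, Matrix.smul_apply, smul_eq_mul]
    rw [div_eq_inv_mul]
  rw [h]
  refine gen (MM (n+1)) _ _ ((Finset.range (n+2)).image (fun j : ℕ => (j : ℚ))) ?_ (trace_aeval n)
  rw [← desc_prod, aeval_desc]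
  ext σ τ
  have : ¬ TT (n+1) (n+2) (τ⁻¹ * σ) := fun h => absurd h.1 (by omega)
  simp [BB, this]

/-- The characteristic polynomial of the top-to-random transition matrix is
`∏_{j=0}^{n} (X - j/n)^{f_j}`, where `f_j` is the number of permutations in `S_n`
with exactly `j` fixed points. -/
theorem stmt5 (n : ℕ) (hn : 1 ≤ n) :
    (Pttr n).charpoly =
      ∏ j ∈ Finset.range (n + 1),
        (Polynomial.X - Polynomial.C ((j : ℚ) / (n : ℚ))) ^
          (Finset.univ.filter (fun σ : Equiv.Perm (Fin n) => fixedPointCount n σ = j)).card := by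
  obtain ⟨n, rfl⟩ : ∃ m, n = m + 1 := ⟨n - 1, by omega⟩
  rw [charpoly_main]
  rw [← Finset.prod_fiberwise_of_maps_to (s := Finset.univ) (t := Finset.range (n+1+1))
    (g := fun σ => fixedPointCount (n+1) σ)]
  · refine Finset.prod_congr rfl fun j _ => ?_
    rw [← Finset.prod_const]
    refine Finset.prod_congr rfl fun σ hσ => ?_
    rw [Finset.mem_filter] at hσ
    rw [hσ.2, div_eq_inv_mul]
  · intro σ _
    rw [Finset.mem_range, Nat.lt_succ_iff]
    exact (Finset.card_le_univ _).trans (by simp)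
end

section
/- For every integer n ≥ 1 and every real parameter q ∈ [0,1], the characteristic polynomial of the top-or-bottom-to-random transition matrix P_q on S_n (a matrix over ℝ indexed by S_n) equals ∏_{j=0}^{n} (X − j/n)^{f_j}, where f_j is the number of permutations in S_n with exactly j fixed points; in particular, the eigenvalues and their multiplicities do not depend on q and coincide with those of the top-to-random shuffle. -/
open Finset

/-- the cycle `e_i` (0-indexed): sends `j ↦ j-1` for `j > i`, `i ↦ n-1`, fixes `j < i`.
(`Fin.cycleRange i` is the cycle `c_i` (0-indexed): sends `j ↦ j+1` for `j < i`,
`i ↦ 0`, fixes `j > i`.) -/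
def botCycle (n : ℕ) (i : Fin n) : Equiv.Perm (Fin n) :=
  Fin.revPerm * Fin.cycleRange i.rev * Fin.revPerm

/-- top-or-bottom-to-random transition matrix with parameter `q`:
with probability `q` remove the top card and reinsert it at a uniform position,
otherwise do the same with the bottom card. -/
noncomputable def Pq (n : ℕ) (q : ℝ) : Matrix (Equiv.Perm (Fin n)) (Equiv.Perm (Fin n)) ℝ :=
  fun σ τ =>
    q / n * ((Finset.univ.filter (fun i : Fin n => τ = σ * Fin.cycleRange i)).card : ℝ) +
    (1 - q) / n * ((Finset.univ.filter (fun i : Fin n => τ = σ * botCycle n i)).card : ℝ)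

section TracePart
open Matrix Polynomial

theorem jacobi_charpoly {N : Type*} [Fintype N] [DecidableEq N] (M : Matrix N N ℝ) :
    derivative M.charpoly = (adjugate (charmatrix M)).trace := by
  have h1 : ∀ i j, derivative (charmatrix M i j) = if i = j then 1 else 0 := by
    intro i j
    by_cases h : i = j
    · subst h; simp
    · simp [h]
  have h2 : ∀ i, adjugate (charmatrix M) i i
      = ((charmatrix M).updateRow i (Pi.single i 1)).det := by
    intro i; rw [adjugate_apply]
  rw [Matrix.trace, Matrix.charpoly]
  simp only [diag_apply, h2, det_apply', derivative_sum]
  rw [Finset.sum_comm]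
  refine Finset.sum_congr rfl fun σ _ => ?_
  have : ((Equiv.Perm.sign σ : ℤ) : ℝ[X]) = C ((Equiv.Perm.sign σ : ℤ) : ℝ) := by simp
  rw [this, derivative_C_mul, derivative_prod_finset, ← Finset.mul_sum]
  congr 1
  rw [← Equiv.sum_comp σ (fun i => ∏ j, (charmatrix M).updateRow i (Pi.single i 1) (σ j) j)]
  refine Finset.sum_congr rfl fun i _ => ?_
  rw [h1, ← Finset.mul_prod_erase univ _ (Finset.mem_univ i), mul_comm]
  congr 1
  · simp [Pi.single_apply, eq_comm]
  · refine Finset.prod_congr rfl fun j hj => ?_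
    rw [updateRow_ne]
    simpa using (Finset.ne_of_mem_erase hj)

noncomputable def adjCoeff {N : Type*} [Fintype N] [DecidableEq N] (M : Matrix N N ℝ) (k : ℕ) :
    Matrix N N ℝ := fun i j => (adjugate (charmatrix M) i j).coeff k

theorem adjCoeff_succ {N : Type*} [Fintype N] [DecidableEq N] (M : Matrix N N ℝ) (k : ℕ) :
    adjCoeff M k = M * adjCoeff M (k+1) + M.charpoly.coeff (k+1) • (1 : Matrix N N ℝ) := by
  have h := mul_adjugate (charmatrix M)
  ext i j
  have h' := congrArg (fun A => (A i j).coeff (k+1)) h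
  have h3 : ((charmatrix M * adjugate (charmatrix M)) i j)
     = X * adjugate (charmatrix M) i j - ∑ l, C (M i l) * adjugate (charmatrix M) l j := by
    rw [charmatrix, sub_mul]
    rw [Matrix.sub_apply, scalar_apply, Matrix.diagonal_mul]
    simp [Matrix.mul_apply]
  simp only [h3] at h'
  simp only [coeff_sub, coeff_X_mul, finsetSum_coeff, coeff_C_mul, Matrix.smul_apply] at h'
  simp only [Matrix.add_apply, Matrix.mul_apply, adjCoeff, Matrix.smul_apply]
  rw [sub_eq_iff_eq_add'] at h'
  rw [h']
  congr 1
  by_cases hij : i = j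
  · subst hij; simp [Matrix.charpoly]
  · simp [hij]

theorem adjCoeff_zero' {N : Type*} [Fintype N] [DecidableEq N] (M : Matrix N N ℝ) :
    0 = M * adjCoeff M 0 + M.charpoly.coeff 0 • (1 : Matrix N N ℝ) := by
  have h := mul_adjugate (charmatrix M)
  ext i j
  have h' := congrArg (fun A => (A i j).coeff 0) h
  have h3 : ((charmatrix M * adjugate (charmatrix M)) i j)
     = X * adjugate (charmatrix M) i j - ∑ l, C (M i l) * adjugate (charmatrix M) l j := by
    rw [charmatrix, sub_mul]
    rw [Matrix.sub_apply, scalar_apply, Matrix.diagonal_mul]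
    simp [Matrix.mul_apply]
  simp only [h3] at h'
  simp only [coeff_sub, finsetSum_coeff, coeff_C_mul, Matrix.smul_apply, coeff_X_mul_zero] at h'
  simp only [Matrix.add_apply, Matrix.mul_apply, adjCoeff, Matrix.smul_apply, Matrix.zero_apply]
  rw [sub_eq_iff_eq_add'] at h'
  rw [h']
  congr 1
  by_cases hij : i = j
  · subst hij; simp [Matrix.charpoly]
  · simp [hij]

theorem trace_adjCoeff {N : Type*} [Fintype N] [DecidableEq N] (M : Matrix N N ℝ) (k : ℕ) :
    (adjCoeff M k).trace = M.charpoly.coeff (k+1) * (k+1) := by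
  rw [← coeff_derivative, jacobi_charpoly]
  simp [Matrix.trace, adjCoeff]

theorem adjCoeff_large {N : Type*} [Fintype N] [DecidableEq N] (M : Matrix N N ℝ) :
    ∃ K, ∀ k, K ≤ k → adjCoeff M k = 0 ∧ M.charpoly.coeff (k+1) = 0 := by
  refine ⟨(∑ i, ∑ j, (adjugate (charmatrix M) i j).natDegree) + 1 + M.charpoly.natDegree, ?_⟩
  intro k hk
  constructor
  · ext i j
    apply coeff_eq_zero_of_natDegree_lt
    have h1 : (adjugate (charmatrix M) i j).natDegree ≤
        ∑ j, (adjugate (charmatrix M) i j).natDegree :=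
      Finset.single_le_sum (f := fun j => (adjugate (charmatrix M) i j).natDegree)
        (fun _ _ => Nat.zero_le _) (mem_univ j)
    have h2 := Finset.single_le_sum
      (f := fun i => ∑ j, (adjugate (charmatrix M) i j).natDegree)
        (fun _ _ => Nat.zero_le _) (mem_univ i)
    omega
  · apply coeff_eq_zero_of_natDegree_lt
    omega

theorem charpoly_eq_of_trace_pow_s6 {N : Type*} [Fintype N] [DecidableEq N] (M D : Matrix N N ℝ)
    (h : ∀ k : ℕ, (M ^ k).trace = (D ^ k).trace) : M.charpoly = D.charpoly := by
  rcases isEmpty_or_nonempty N with hN | hN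
  · rw [Subsingleton.elim M D]
  obtain ⟨K1, hK1⟩ := adjCoeff_large M
  obtain ⟨K2, hK2⟩ := adjCoeff_large D
  have key : ∀ m k : ℕ, K1 + K2 ≤ k + m → M.charpoly.coeff (k+1) = D.charpoly.coeff (k+1) ∧
      ∀ a, (M ^ a * adjCoeff M k).trace = (D ^ a * adjCoeff D k).trace := by
    intro m
    induction m with
    | zero =>
      intro k hk
      have a1 := hK1 k (by omega)
      have a2 := hK2 k (by omega)
      simp [a1.1, a1.2, a2.1, a2.2]
    | succ m ih =>
      intro k hk
      have ih' := (ih (k+1) (by omega)).2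
      have hc : M.charpoly.coeff (k+1) = D.charpoly.coeff (k+1) := by
        by_cases hkN : k + 1 = Fintype.card N
        · have e1 := M.charpoly_monic.coeff_natDegree
          have e2 := D.charpoly_monic.coeff_natDegree
          rw [charpoly_natDegree_eq_dim] at e1 e2
          rw [hkN, e1, e2]
        · have t1 := trace_adjCoeff M k
          have t2 := trace_adjCoeff D k
          rw [adjCoeff_succ, trace_add, trace_smul, trace_one] at t1 t2
          have i1 := ih' 1
          simp only [pow_one] at i1
          have hne : ((k:ℝ) + 1 - Fintype.card N) ≠ 0 := by
            intro h0
            apply hkN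
            have : ((k + 1 : ℕ) : ℝ) = Fintype.card N := by push_cast; linarith
            exact_mod_cast this
          apply mul_right_cancel₀ hne
          simp only [smul_eq_mul] at t1 t2
          linarith
      refine ⟨hc, fun a => ?_⟩
      rw [adjCoeff_succ M, adjCoeff_succ D, mul_add, mul_add, ← mul_assoc, ← mul_assoc,
        ← pow_succ, ← pow_succ, trace_add, trace_add, ih', hc]
      simp [h a]
  ext k
  rcases k with _ | k
  · have z1 := congrArg trace (adjCoeff_zero' M)
    have z2 := congrArg trace (adjCoeff_zero' D)
    rw [trace_add, trace_smul, trace_one] at z1 z2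
    have i1 := (key (K1 + K2) 0 (by omega)).2 1
    simp only [pow_one, smul_eq_mul] at i1 z1 z2
    have hne : (Fintype.card N : ℝ) ≠ 0 := by
      simp
    apply mul_right_cancel₀ hne
    linarith
  · exact (key (K1 + K2) k (by omega)).1

end TracePart

section WordPart

theorem val_cycleRange {n : ℕ} (i j : Fin n) : (Fin.cycleRange i j : ℕ) =
    if (j : ℕ) < i then (j : ℕ) + 1 else if (j : ℕ) = i then 0 else j := by
  rcases lt_trichotomy j i with h | h | h
  · rw [Fin.coe_cycleRange_of_lt h, if_pos (by exact h)]
  · subst h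
    rw [Fin.coe_cycleRange_of_le le_rfl]; simp
  · rw [Fin.cycleRange_of_gt h]
    have : (i : ℕ) < j := h
    rw [if_neg (by omega), if_neg (by omega)]

theorem val_botCycle {n : ℕ} (i j : Fin n) : (botCycle n i j : ℕ) =
    if (i : ℕ) < j then (j : ℕ) - 1 else if (j : ℕ) = i then n - 1 else j := by
  have hi := i.isLt
  have hj := j.isLt
  simp only [botCycle, Equiv.Perm.mul_apply, Fin.revPerm_apply, Fin.val_rev, val_cycleRange]
  split_ifs <;> omega

/-- move card `l.1` to the top or to the bottom; `ρ` maps cards to positions. -/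
def cardMove (n : ℕ) (l : Fin n × Bool) (ρ : Equiv.Perm (Fin n)) : Equiv.Perm (Fin n) :=
  (if l.2 = true then Fin.cycleRange (ρ l.1) else botCycle n (ρ l.1)) * ρ

def wordMove (n : ℕ) : List (Fin n × Bool) → Equiv.Perm (Fin n) → Equiv.Perm (Fin n)
  | [], ρ => ρ
  | l :: W, ρ => cardMove n l (wordMove n W ρ)

theorem val_cardMove_true {n : ℕ} (y : Fin n) (ρ : Equiv.Perm (Fin n)) (x : Fin n) :
    (cardMove n (y, true) ρ x : ℕ) =
      if (ρ x : ℕ) < ρ y then (ρ x : ℕ) + 1 else if (ρ x : ℕ) = ρ y then 0 else ρ x := by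
  simp [cardMove, val_cycleRange]

theorem val_cardMove_false {n : ℕ} (y : Fin n) (ρ : Equiv.Perm (Fin n)) (x : Fin n) :
    (cardMove n (y, false) ρ x : ℕ) =
      if (ρ y : ℕ) < ρ x then (ρ x : ℕ) - 1 else if (ρ x : ℕ) = ρ y then n - 1 else ρ x := by
  simp [cardMove, val_botCycle]

theorem perm_val_ne {n : ℕ} (ρ : Equiv.Perm (Fin n)) {x y : Fin n} (h : x ≠ y) :
    (ρ x : ℕ) ≠ ρ y := by
  intro h'
  exact h (ρ.injective (Fin.ext h'))

theorem word_invariant (n : ℕ) (W : List (Fin n × Bool)) :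
    ∃ a c : ℕ, a ≤ c ∧ c ≤ n ∧
      (∀ ρ x, x ∈ W.map Prod.fst →
        ((wordMove n W ρ x : ℕ) < a ∨ c ≤ (wordMove n W ρ x : ℕ))) ∧
      (∀ ρ x, x ∉ W.map Prod.fst →
        (a ≤ (wordMove n W ρ x : ℕ) ∧ (wordMove n W ρ x : ℕ) < c)) ∧
      (∀ ρ x, x ∈ W.map Prod.fst →
        (wordMove n W ρ x : ℕ) = (wordMove n W 1 x : ℕ)) := by
  induction W with
  | nil => exact ⟨0, n, by simp⟩
  | cons l W ih =>
    obtain ⟨a, c, hac, hcn, h1, h2, h3⟩ := ih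
    obtain ⟨y, s⟩ := l
    have hlt : ∀ ρ x, (wordMove n W ρ x : ℕ) < n := fun ρ x => (wordMove n W ρ x).isLt
    have hne : ∀ ρ x, x ≠ y → (wordMove n W ρ x : ℕ) ≠ wordMove n W ρ y :=
      fun ρ x h => perm_val_ne _ h
    by_cases hy : y ∈ W.map Prod.fst
    · -- the letter occurred before
      have hmem : ∀ x, x ∈ ((y, s) :: W).map Prod.fst ↔ x ∈ W.map Prod.fst := by
        intro x
        simp only [List.map_cons, List.mem_cons]
        constructor
        · rintro (rfl | h)
          · exact hy
          · exact h
        · exact Or.inr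
      simp only [hmem, wordMove]
      have hp1 := h1 1 y hy
      have hpy := fun ρ => h3 ρ y hy
      have hlt1 := hlt 1 y
      cases s with
      | true =>
        simp only [val_cardMove_true, hpy]
        generalize (wordMove n W 1 y : ℕ) = p at *
        rcases hp1 with hp | hp
        · refine ⟨a, c, hac, hcn, ?_, ?_, ?_⟩
          · intro ρ x hx
            have := h1 ρ x hx
            split_ifs <;> omega
          · intro ρ x hx
            have := h2 ρ x hx
            split_ifs <;> omega
          · intro ρ x hx
            have := h3 ρ x hx
            rw [this]
        · refine ⟨a + 1, c + 1, by omega, by omega, ?_, ?_, ?_⟩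
          · intro ρ x hx
            have := h1 ρ x hx
            split_ifs <;> omega
          · intro ρ x hx
            have := h2 ρ x hx
            split_ifs <;> omega
          · intro ρ x hx
            have := h3 ρ x hx
            rw [this]
      | false =>
        simp only [val_cardMove_false, hpy]
        generalize (wordMove n W 1 y : ℕ) = p at *
        rcases hp1 with hp | hp
        · refine ⟨a - 1, c - 1, by omega, by omega, ?_, ?_, ?_⟩
          · intro ρ x hx
            have := h1 ρ x hx
            split_ifs <;> omega
          · intro ρ x hx
            have := h2 ρ x hx
            split_ifs <;> omega
          · intro ρ x hx
            have := h3 ρ x hx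
            rw [this]
        · refine ⟨a, c, hac, hcn, ?_, ?_, ?_⟩
          · intro ρ x hx
            have := h1 ρ x hx
            have := hlt ρ x
            split_ifs <;> omega
          · intro ρ x hx
            have := h2 ρ x hx
            split_ifs <;> omega
          · intro ρ x hx
            have := h3 ρ x hx
            rw [this]
    · have hpy := fun ρ => h2 ρ y hy
      have hmem : ∀ x, x ∈ ((y, s) :: W).map Prod.fst ↔ x = y ∨ x ∈ W.map Prod.fst := by
        intro x; simp only [List.map_cons, List.mem_cons]
      simp only [hmem, wordMove]
      cases s with
      | true =>
        simp only [val_cardMove_true]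
        have := hpy 1
        refine ⟨a + 1, c, by omega, hcn, ?_, ?_, ?_⟩
        · rintro ρ x (rfl | hx)
          · simp
          · have := h1 ρ x hx
            have := hpy ρ
            split_ifs <;> omega
        · intro ρ x hx
          push Not at hx
          have := h2 ρ x hx.2
          have := hpy ρ
          have := hne ρ x hx.1
          split_ifs <;> omega
        · rintro ρ x (rfl | hx)
          · simp
          · have := h1 ρ x hx
            have := hpy ρ
            have := h1 1 x hx
            have := hpy 1
            have := h3 ρ x hx
            split_ifs <;> omega
      | false =>
        simp only [val_cardMove_false]
        have := hpy 1
        refine ⟨a, c - 1, by omega, by omega, ?_, ?_, ?_⟩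
        · rintro ρ x (rfl | hx)
          · simp; omega
          · have := h1 ρ x hx
            have := hpy ρ
            split_ifs <;> omega
        · intro ρ x hx
          push Not at hx
          have := h2 ρ x hx.2
          have := hpy ρ
          have := hne ρ x hx.1
          split_ifs <;> omega
        · rintro ρ x (rfl | hx)
          · simp
          · have := h1 ρ x hx
            have := hpy ρ
            have := h1 1 x hx
            have := hpy 1
            have := h3 ρ x hx
            split_ifs <;> omega

theorem word_order (n : ℕ) (W : List (Fin n × Bool)) (ρ : Equiv.Perm (Fin n)) (x z : Fin n)
    (hx : x ∉ W.map Prod.fst) (hz : z ∉ W.map Prod.fst) :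
    (wordMove n W ρ x : ℕ) < wordMove n W ρ z ↔ (ρ x : ℕ) < ρ z := by
  induction W with
  | nil => simp [wordMove]
  | cons l W ih =>
    obtain ⟨y, s⟩ := l
    simp only [List.map_cons, List.mem_cons, not_or] at hx hz
    rw [← ih hx.2 hz.2]
    have a1 := perm_val_ne (wordMove n W ρ) hx.1
    have a2 := perm_val_ne (wordMove n W ρ) hz.1
    simp only [wordMove]
    cases s with
    | true =>
      simp only [val_cardMove_true]
      split_ifs <;> omega
    | false =>
      simp only [val_cardMove_false]
      split_ifs <;> omega

theorem perm_eq_of_order {n : ℕ} (ρ σ : Equiv.Perm (Fin n))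
    (h : ∀ x z, (ρ x : ℕ) < ρ z ↔ (σ x : ℕ) < σ z) : ρ = σ := by
  have hm : StrictMono (σ * ρ⁻¹ : Equiv.Perm (Fin n)) := by
    intro i j hij
    have := (h (ρ⁻¹ i) (ρ⁻¹ j)).1 (by simpa using hij)
    exact this
  have h2 := Subsingleton.elim (α := Fin n ≃o Fin n)
    (StrictMono.orderIsoOfSurjective _ hm (σ * ρ⁻¹ : Equiv.Perm (Fin n)).surjective)
    (OrderIso.refl _)
  ext x
  have h3 := congrArg (fun f : Fin n ≃o Fin n => f (ρ x)) h2
  simp at h3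
  rw [h3]

theorem word_fixed (n : ℕ) (W : List (Fin n × Bool)) :
    wordMove n W (wordMove n W 1) = wordMove n W 1 := by
  obtain ⟨a, c, hac, hcn, h1, h2, h3⟩ := word_invariant n W
  apply perm_eq_of_order
  intro x z
  set σ := wordMove n W 1 with hσ
  by_cases hx : x ∈ W.map Prod.fst <;> by_cases hz : z ∈ W.map Prod.fst
  · rw [h3 _ x hx, h3 _ z hz]
  · rw [h3 _ x hx]
    have := h1 1 x hx
    have := h2 1 z hz
    have := h2 σ z hz
    rw [← hσ] at *
    omega
  · rw [h3 _ z hz]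
    have := h1 1 z hz
    have := h2 1 x hx
    have := h2 σ x hx
    rw [← hσ] at *
    omega
  · exact word_order n W σ x z hx hz

theorem word_equivariant (n : ℕ) (W : List (Fin n × Bool)) (ρ π : Equiv.Perm (Fin n))
    (h : ∀ x ∈ W.map Prod.fst, π x = x) : wordMove n W (ρ * π) = wordMove n W ρ * π := by
  induction W with
  | nil => rfl
  | cons l W ih =>
    simp only [List.map_cons, List.mem_cons, forall_eq_or_imp] at h
    simp only [wordMove, ih h.2, cardMove, Equiv.Perm.mul_apply, h.1, mul_assoc]

theorem card_fixed_word (n : ℕ) (W : List (Fin n × Bool)) :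
    (univ.filter (fun ρ => ρ = wordMove n W ρ)).card =
      (univ.filter (fun π : Equiv.Perm (Fin n) => ∀ x ∈ W.map Prod.fst, π x = x)).card := by
  obtain ⟨a, c, hac, hcn, h1, h2, h3⟩ := word_invariant n W
  symm
  set σ := wordMove n W 1 with hσ
  apply Finset.card_bij (fun π _ => σ * π)
  · intro π hπ
    simp only [mem_filter, mem_univ, true_and] at hπ ⊢
    rw [word_equivariant n W σ π hπ, hσ, word_fixed]
  · intro π _ π' _ h
    exact mul_left_cancel h
  · intro ρ hρ
    simp only [mem_filter, mem_univ, true_and] at hρ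
    refine ⟨σ⁻¹ * ρ, ?_, by simp⟩
    simp only [mem_filter, mem_univ, true_and]
    intro x hx
    have h := h3 ρ x hx
    rw [← hρ] at h
    have h' : ρ x = σ x := Fin.ext h
    simp [h']

end WordPart

section Assembly
open Matrix Polynomial

noncomputable def funMat {S : Type*} [DecidableEq S] (f : S → S) : Matrix S S ℝ :=
  fun a b => if b = f a then 1 else 0

theorem funMat_mul {S : Type*} [DecidableEq S] [Fintype S] (f g : S → S) :
    funMat f * funMat g = funMat (fun a => g (f a)) := by
  ext a b
  simp only [funMat, Matrix.mul_apply, ite_mul, one_mul, zero_mul]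
  rw [Finset.sum_ite_eq' univ (f a)]
  simp

theorem funMat_trace {S : Type*} [DecidableEq S] [Fintype S] (f : S → S) :
    (funMat f).trace = ((univ.filter (fun a => a = f a)).card : ℝ) := by
  simp [funMat, Matrix.trace]

noncomputable def letterWt (n : ℕ) (q : ℝ) (l : Fin n × Bool) : ℝ :=
  if l.2 = true then q / n else (1 - q) / n

noncomputable def Qmat (n : ℕ) (q : ℝ) : Matrix (Equiv.Perm (Fin n)) (Equiv.Perm (Fin n)) ℝ :=
  ∑ l : Fin n × Bool, letterWt n q l • funMat (cardMove n l)

theorem Qmat_pow (n : ℕ) (q : ℝ) (k : ℕ) : (Qmat n q) ^ k =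
    ∑ W : Fin k → Fin n × Bool,
      (∏ i, letterWt n q (W i)) • funMat (wordMove n (List.ofFn W)) := by
  induction k with
  | zero =>
    simp only [pow_zero, univ_unique, sum_singleton, univ_eq_empty, prod_empty, one_smul,
      List.ofFn_zero]
    ext a b
    simp [funMat, wordMove, Matrix.one_apply, eq_comm]
  | succ k ih =>
    rw [pow_succ, ih]
    conv_lhs => rw [Qmat]
    rw [Finset.mul_sum, ← (Fin.consEquiv (fun _ => Fin n × Bool)).sum_comp]
    conv_rhs => rw [Fintype.sum_prod_type]
    refine Finset.sum_congr rfl fun l _ => ?_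
    rw [Finset.sum_mul]
    refine Finset.sum_congr rfl fun W _ => ?_
    rw [smul_mul_smul_comm, funMat_mul]
    simp only [Fin.consEquiv_apply, Fin.prod_univ_succ, Fin.cons_zero, Fin.cons_succ,
      List.ofFn_succ, wordMove]
    rw [mul_comm]

theorem Qmat_trace (n : ℕ) (hn : 1 ≤ n) (q : ℝ) (k : ℕ) : ((Qmat n q) ^ k).trace =
    ((diagonal fun π : Equiv.Perm (Fin n) => (fixedPointCount n π : ℝ) / n) ^ k).trace := by
  have hn' : (n : ℝ) ≠ 0 := by positivity
  have h1 : ∀ π : Equiv.Perm (Fin n), (fixedPointCount n π : ℝ) / n =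
      ∑ l : Fin n × Bool, letterWt n q l * (if π l.1 = l.1 then 1 else 0) := by
    intro π
    rw [Fintype.sum_prod_type]
    simp only [Fintype.sum_bool, letterWt, fixedPointCount]
    rw [Finset.card_filter]
    push_cast
    rw [Finset.sum_div]
    refine Finset.sum_congr rfl fun x _ => ?_
    split_ifs <;> simp_all
    field_simp
    ring
  rw [diagonal_pow, trace_diagonal, Qmat_pow, trace_sum]
  simp only [Pi.pow_apply, h1, Fintype.sum_pow, Finset.prod_mul_distrib]
  rw [Finset.sum_comm]
  refine Finset.sum_congr rfl fun W _ => ?_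
  rw [trace_smul, funMat_trace, card_fixed_word, ← Finset.mul_sum, smul_eq_mul]
  congr 1
  rw [Finset.card_filter]
  push_cast
  refine Finset.sum_congr rfl fun π _ => ?_
  rw [Finset.prod_ite_zero]
  simp [List.mem_ofFn]

theorem Pq_eq (n : ℕ) (q : ℝ) :
    Pq n q = (reindex (Equiv.inv (Equiv.Perm (Fin n))) (Equiv.inv _) (Qmat n q))ᵀ := by
  ext σ τ
  have τ_inv_self : ∀ x, τ⁻¹ (τ x) = x := fun x => by simp
  rw [transpose_apply, reindex_apply, submatrix_apply, Qmat, Matrix.sum_apply,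
    Fintype.sum_prod_type]
  simp only [Fintype.sum_bool, Matrix.smul_apply, letterWt, funMat, smul_eq_mul,
    Finset.sum_add_distrib, Equiv.inv_symm, Equiv.inv_apply, cardMove, Pq, if_true]
  rw [← Finset.mul_sum, ← Equiv.sum_comp τ]
  simp only [τ_inv_self]
  rw [← Equiv.sum_comp τ (fun x => ite (false = true) _ _ * _)]
  simp only [τ_inv_self, Bool.false_eq_true, if_false]
  rw [← Finset.mul_sum, Finset.card_filter, Finset.card_filter]
  push_cast
  have key : ∀ g : Equiv.Perm (Fin n), (τ = σ * g) ↔ (σ⁻¹ = g * τ⁻¹) := by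
    intro g
    rw [eq_mul_inv_iff_mul_eq, inv_mul_eq_iff_eq_mul]
  simp only [key]

end Assembly

theorem stmt6 (n : ℕ) (hn : 1 ≤ n) (q : ℝ) (hq : q ∈ Set.Icc (0 : ℝ) 1) :
    (Pq n q).charpoly =
      ∏ j ∈ Finset.range (n + 1),
        (Polynomial.X - Polynomial.C ((j : ℝ) / (n : ℝ))) ^
          (Finset.univ.filter (fun σ : Equiv.Perm (Fin n) => fixedPointCount n σ = j)).card := by
  rw [Pq_eq, Matrix.charpoly_transpose, Matrix.charpoly_reindex,
    charpoly_eq_of_trace_pow_s6 _ _ (Qmat_trace n hn q), Matrix.charpoly_diagonal,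
    ← Finset.prod_fiberwise_of_maps_to (s := Finset.univ) (t := Finset.range (n + 1))
      (g := fun σ : Equiv.Perm (Fin n) => fixedPointCount n σ)]
  · refine Finset.prod_congr rfl fun j _ => ?_
    rw [← Finset.prod_const]
    refine Finset.prod_congr rfl fun σ hσ => ?_
    rw [(Finset.mem_filter.1 hσ).2]
  · intro σ _
    rw [Finset.mem_range, Nat.lt_succ_iff]
    exact (Finset.card_le_univ _).trans (by simp)
end

section
/- For every integer n ≥ 1 and every real parameter q ∈ [0,1], the top-or-bottom-to-random transition matrix P_q on S_n is diagonalizable over ℝ (i.e., ℝ^{S_n} admits a basis of eigenvectors of P_q). In particular (q = 1) the top-to-random transition matrix is diagonalizable. -/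
open Finset

open Polynomial

lemma cyc_lt {n : ℕ} (p x y : Fin n) :
    Fin.cycleRange p x < Fin.cycleRange p y ↔ y ≠ p ∧ (x = p ∨ x < y) := by
  have key : ∀ z : Fin n, (Fin.cycleRange p z : ℕ) =
      if z < p then (z : ℕ) + 1 else if z = p then 0 else z := by
    intro z
    rcases lt_trichotomy z p with h | h | h
    · rw [if_pos h, Fin.coe_cycleRange_of_lt h]
    · subst h
      have : NeZero n := ⟨fun h => by subst h; exact z.elim0⟩
      simp [Fin.cycleRange_self]
    · rw [if_neg (not_lt.2 h.le), if_neg h.ne', Fin.cycleRange_of_gt h]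
  rw [Fin.lt_def, key, key]
  simp only [Fin.lt_def, Fin.ext_iff, ne_eq]
  split_ifs <;> omega

lemma bot_lt {n : ℕ} (p x y : Fin n) :
    botCycle n p x < botCycle n p y ↔ x ≠ p ∧ (y = p ∨ x < y) := by
  simp only [botCycle, Equiv.Perm.mul_apply, Fin.revPerm_apply, Fin.rev_lt_rev, cyc_lt,
    ne_eq, Fin.rev_inj]

def topMove {n : ℕ} (a : Fin n) (σ : Equiv.Perm (Fin n)) : Equiv.Perm (Fin n) :=
  σ * (Fin.cycleRange (σ⁻¹ a))⁻¹

def botMove {n : ℕ} (a : Fin n) (σ : Equiv.Perm (Fin n)) : Equiv.Perm (Fin n) :=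
  σ * (botCycle n (σ⁻¹ a))⁻¹

lemma topMove_lt {n : ℕ} (a b c : Fin n) (σ : Equiv.Perm (Fin n)) :
    (topMove a σ)⁻¹ b < (topMove a σ)⁻¹ c ↔ c ≠ a ∧ (b = a ∨ σ⁻¹ b < σ⁻¹ c) := by
  simp only [topMove, mul_inv_rev, inv_inv, Equiv.Perm.mul_apply, cyc_lt, ne_eq,
    EmbeddingLike.apply_eq_iff_eq]

lemma botMove_lt {n : ℕ} (a b c : Fin n) (σ : Equiv.Perm (Fin n)) :
    (botMove a σ)⁻¹ b < (botMove a σ)⁻¹ c ↔ b ≠ a ∧ (c = a ∨ σ⁻¹ b < σ⁻¹ c) := by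
  simp only [botMove, mul_inv_rev, inv_inv, Equiv.Perm.mul_apply, bot_lt, ne_eq,
    EmbeddingLike.apply_eq_iff_eq]

lemma perm_ext_lt {n : ℕ} {σ τ : Equiv.Perm (Fin n)}
    (h : ∀ b c, σ⁻¹ b < σ⁻¹ c ↔ τ⁻¹ b < τ⁻¹ c) : σ = τ := by
  have hm : StrictMono (τ⁻¹ * σ : Equiv.Perm (Fin n)) := by
    intro x y hxy
    have := h (σ x) (σ y)
    simp only [Equiv.Perm.inv_def, Equiv.symm_apply_apply] at this
    exact this.1 hxy
  have h2 : ((hm.orderIsoOfSurjective _ (τ⁻¹ * σ : Equiv.Perm (Fin n)).surjective)) =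
      OrderIso.refl (Fin n) := Subsingleton.elim _ _
  have h3 : (τ⁻¹ * σ : Equiv.Perm (Fin n)) = 1 := by
    ext x
    have := DFunLike.congr_fun h2 x
    simpa using congrArg Fin.val this
  exact (inv_mul_eq_one.1 h3).symm

/-- same arrangement after deleting card `a` -/
def CardRel {n : ℕ} (a : Fin n) (σ τ : Equiv.Perm (Fin n)) : Prop :=
  ∀ b c, b ≠ a → c ≠ a → (σ⁻¹ b < σ⁻¹ c ↔ τ⁻¹ b < τ⁻¹ c)

lemma CardRel.top {n : ℕ} {a : Fin n} {σ τ : Equiv.Perm (Fin n)} (h : CardRel a σ τ) (d : Fin n) :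
    CardRel a (topMove d σ) (topMove d τ) := by
  intro b c hb hc
  rw [topMove_lt, topMove_lt, h b c hb hc]

lemma CardRel.bot {n : ℕ} {a : Fin n} {σ τ : Equiv.Perm (Fin n)} (h : CardRel a σ τ) (d : Fin n) :
    CardRel a (botMove d σ) (botMove d τ) := by
  intro b c hb hc
  rw [botMove_lt, botMove_lt, h b c hb hc]

lemma rel_top {n : ℕ} (a : Fin n) (σ : Equiv.Perm (Fin n)) : CardRel a (topMove a σ) σ := by
  intro b c hb hc
  rw [topMove_lt]; tauto

lemma rel_bot {n : ℕ} (a : Fin n) (σ : Equiv.Perm (Fin n)) : CardRel a (botMove a σ) σ := by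
  intro b c hb hc
  rw [botMove_lt]; tauto

lemma CardRel.top_eq {n : ℕ} {a : Fin n} {σ τ : Equiv.Perm (Fin n)} (h : CardRel a σ τ) :
    topMove a σ = topMove a τ := by
  apply perm_ext_lt
  intro b c
  rw [topMove_lt, topMove_lt]
  have := h b c
  tauto

lemma CardRel.bot_eq {n : ℕ} {a : Fin n} {σ τ : Equiv.Perm (Fin n)} (h : CardRel a σ τ) :
    botMove a σ = botMove a τ := by
  apply perm_ext_lt
  intro b c
  rw [botMove_lt, botMove_lt]
  have := h b c
  tauto

/-- move card `a` to the top or the bottom -/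
noncomputable def moveOp {n : ℕ} (q : ℝ) (a : Fin n) (f : Equiv.Perm (Fin n) → ℝ) :
    Equiv.Perm (Fin n) → ℝ :=
  fun σ => q * f (topMove a σ) + (1 - q) * f (botMove a σ)

def CardInv {n : ℕ} (a : Fin n) (f : Equiv.Perm (Fin n) → ℝ) : Prop :=
  ∀ σ τ, CardRel a σ τ → f σ = f τ

lemma G_inv_self {n : ℕ} (q : ℝ) (a : Fin n) (f : Equiv.Perm (Fin n) → ℝ) :
    CardInv a (moveOp q a f) := by
  intro σ τ h
  simp only [moveOp, h.top_eq, h.bot_eq]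

lemma CardInv.G {n : ℕ} (q : ℝ) {a : Fin n} (b : Fin n) {f : Equiv.Perm (Fin n) → ℝ}
    (hf : CardInv a f) : CardInv a (moveOp q b f) := by
  intro σ τ h
  simp only [moveOp, hf _ _ (h.top b), hf _ _ (h.bot b)]

lemma CardInv.G_eq {n : ℕ} (q : ℝ) {a : Fin n} {f : Equiv.Perm (Fin n) → ℝ}
    (hf : CardInv a f) : moveOp q a f = f := by
  funext σ
  simp only [moveOp, hf _ _ (rel_top a σ), hf _ _ (rel_bot a σ)]
  ring

noncomputable def W {n : ℕ} (q : ℝ) (l : List (Fin n)) (f : Equiv.Perm (Fin n) → ℝ) :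
    Equiv.Perm (Fin n) → ℝ := l.foldr (moveOp q) f

lemma W_inv {n : ℕ} (q : ℝ) (l : List (Fin n)) (f : Equiv.Perm (Fin n) → ℝ) (a : Fin n)
    (ha : a ∈ l) : CardInv a (W q l f) := by
  induction l with
  | nil => simp at ha
  | cons b l ih =>
    change CardInv a (moveOp q b (W q l f))
    rcases List.mem_cons.1 ha with rfl | h
    · exact G_inv_self _ _ _
    · exact (ih h).G q b

def V (n : ℕ) (q : ℝ) (k : ℕ) : Submodule ℝ (Equiv.Perm (Fin n) → ℝ) :=
  Submodule.span ℝ {g | ∃ l : List (Fin n), l.Nodup ∧ l.length = k ∧ ∃ f, g = W q l f}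

lemma toLin_eq (n : ℕ) (hn : 1 ≤ n) (q : ℝ) (f : Equiv.Perm (Fin n) → ℝ) :
    (n : ℝ) • Matrix.toLin' (Pq n q).transpose f = ∑ a, moveOp q a f := by
  have hn' : (n : ℝ) ≠ 0 := by positivity
  funext σ
  have e : ∀ c : Fin n → Equiv.Perm (Fin n),
      ∑ τ, ((Finset.univ.filter (fun i : Fin n => σ = τ * c i)).card : ℝ) * f τ =
        ∑ a, f (σ * (c (σ⁻¹ a))⁻¹) := by
    intro c
    rw [Equiv.sum_comp (σ⁻¹ : Equiv.Perm (Fin n)) (fun i => f (σ * (c i)⁻¹))]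
    simp only [Finset.card_filter, Nat.cast_sum, Finset.sum_mul]
    rw [Finset.sum_comm]
    refine Finset.sum_congr rfl fun i _ => ?_
    simp only [← mul_inv_eq_iff_eq_mul]
    simp
  simp only [Pi.smul_apply, Matrix.toLin'_apply, Matrix.mulVec, dotProduct,
    Matrix.transpose_apply, Pq, smul_eq_mul, Finset.sum_apply, moveOp, add_mul, mul_assoc,
    Finset.sum_add_distrib, ← Finset.mul_sum, e, topMove, botMove]
  field_simp

lemma step (n : ℕ) (hn : 1 ≤ n) (q : ℝ) (k : ℕ) (f : Equiv.Perm (Fin n) → ℝ)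
    (hf : f ∈ V n q k) :
    Matrix.toLin' (Pq n q).transpose f - ((k : ℝ) / n) • f ∈ V n q (k + 1) := by
  have hn' : (n : ℝ) ≠ 0 := by positivity
  suffices h : V n q k ≤ (V n q (k+1)).comap
      (Matrix.toLin' (Pq n q).transpose - ((k : ℝ) / n) • LinearMap.id) by
    simpa using h hf
  refine Submodule.span_le.2 ?_
  rintro _ ⟨l, hl, hk, f, rfl⟩
  have h1 : (n : ℝ) • (Matrix.toLin' (Pq n q).transpose (W q l f) - ((k : ℝ) / n) • W q l f)
      ∈ V n q (k + 1) := by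
    rw [smul_sub, toLin_eq n hn, smul_smul, mul_div_cancel₀ _ hn',
      ← Finset.sum_add_sum_compl l.toFinset]
    have : ∑ a ∈ l.toFinset, moveOp q a (W q l f) = (k : ℝ) • W q l f := by
      rw [Finset.sum_congr rfl (fun a ha =>
        (W_inv q l f a (List.mem_toFinset.1 ha)).G_eq q), Finset.sum_const,
        List.toFinset_card_of_nodup hl, hk, Nat.cast_smul_eq_nsmul]
    rw [this, add_sub_cancel_left]
    refine Submodule.sum_mem _ fun a ha => Submodule.subset_span ⟨a :: l, ?_, ?_, f, rfl⟩
    · simp at ha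
      exact List.nodup_cons.2 ⟨ha, hl⟩
    · simp [hk]
  have h2 := (V n q (k+1)).smul_mem ((n : ℝ)⁻¹) h1
  rw [smul_smul, inv_mul_cancel₀ hn', one_smul] at h2
  simpa using h2

lemma aeval_mem (n : ℕ) (hn : 1 ≤ n) (q : ℝ) (k : ℕ) (f : Equiv.Perm (Fin n) → ℝ) :
    aeval (Matrix.toLin' (Pq n q).transpose)
      (∏ j ∈ Finset.range k, (X - C ((j : ℝ) / n))) f ∈ V n q k := by
  induction k with
  | zero => exact Submodule.subset_span ⟨[], by simp, by simp, f, by simp [W]⟩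
  | succ k ih =>
    have := step n hn q k _ ih
    rw [Finset.prod_range_succ, mul_comm, map_mul]
    simpa [Module.algebraMap_end_apply] using this

lemma V_top (n : ℕ) (q : ℝ) : V n q (n + 1) = ⊥ := by
  refine Submodule.span_eq_bot.2 ?_
  rintro _ ⟨l, hl, hk, f, rfl⟩
  have := hl.length_le_card
  simp at this
  omega

lemma aeval_transpose' {ι : Type*} [Fintype ι] [DecidableEq ι] (A : Matrix ι ι ℝ) (p : ℝ[X]) :
    aeval A.transpose p = (aeval A p).transpose := by
  induction p using Polynomial.induction_on' with
  | add p q hp hq => simp [hp, hq]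
  | monomial k a =>
    simp [aeval_monomial, Matrix.transpose_mul, Matrix.transpose_pow, Algebra.algebraMap_eq_smul_one]

lemma ker_le {M : Type*} [AddCommGroup M] [Module ℝ M] (f : Module.End ℝ M) (s : Finset ℝ) :
    LinearMap.ker (aeval f (∏ x ∈ s, (X - C x))) ≤ ⨆ μ : ℝ, f.eigenspace μ := by
  induction s using Finset.induction_on with
  | empty => 
    simp only [Finset.prod_empty, map_one]
    intro x hx
    have : x = 0 := by simpa using hx
    simp [this]
  | insert a s ha ih =>
    rw [Finset.prod_insert ha, ← Polynomial.sup_ker_aeval_eq_ker_aeval_mul_of_coprime]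
    · refine sup_le ?_ ih
      refine le_trans (le_of_eq ?_) (le_iSup _ a)
      rw [Module.End.eigenspace_def]
      simp [Algebra.algebraMap_eq_smul_one]
    · refine IsCoprime.prod_right fun i hi => ?_
      exact Polynomial.isCoprime_X_sub_C_of_isUnit_sub
        (sub_ne_zero.2 (fun h : a = i => ha (h ▸ hi))).isUnit

/-- The top-or-bottom-to-random transition matrix is diagonalizable over ℝ:
the eigenspaces of the associated linear endomorphism of `ℝ^{S_n}` span. -/
theorem stmt7 (n : ℕ) (hn : 1 ≤ n) (q : ℝ) (hq : q ∈ Set.Icc (0 : ℝ) 1) :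
    ⨆ μ : ℝ, Module.End.eigenspace (Matrix.toLin' (Pq n q)) μ = ⊤ := by
  have hn' : (n : ℝ) ≠ 0 := by positivity
  set p : ℝ[X] := ∏ j ∈ Finset.range (n + 1), (X - C ((j : ℝ) / n)) with hp
  have h1 : aeval (Matrix.toLin' (Pq n q).transpose) p = 0 := by
    ext1 f
    ext1
    have := aeval_mem n hn q (n + 1)
    simp only [V_top, Submodule.mem_bot] at this
    simp [hp, this]
  have e : ∀ A : Matrix (Equiv.Perm (Fin n)) (Equiv.Perm (Fin n)) ℝ,
      aeval (Matrix.toLin' A) p = Matrix.toLin' (aeval A p) := fun A =>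
    Polynomial.aeval_algHom_apply (Matrix.toLinAlgEquiv' (R := ℝ)).toAlgHom A p
  have h2 : aeval (Matrix.toLin' (Pq n q)) p = 0 := by
    rw [e, aeval_transpose', LinearEquiv.map_eq_zero_iff, Matrix.transpose_eq_zero] at h1
    rw [e, h1, map_zero]
  have h3 : p = ∏ x ∈ (Finset.range (n + 1)).image (fun j : ℕ => (j : ℝ) / n), (X - C x) := by
    rw [hp, Finset.prod_image]
    intro i _ j _ h
    simpa [div_left_inj' hn'] using h
  rw [eq_top_iff]
  refine le_trans ?_ (ker_le _ ((Finset.range (n + 1)).image (fun j : ℕ => (j : ℝ) / n)))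
  rw [← h3, h2, LinearMap.ker_zero]
end

section
/- Let n ≥ 1 and a ≥ 1 be integers and let P_a be the a-handed riffle shuffle transition matrix on S_n. Then for every integer t ≥ 0, the entry of the vector P_a^t · des at the identity permutation equals (1 − a^{−t})·(n−1)/2, where des : S_n → ℚ is the number-of-descents function. (In words: if a deck of n distinct cards starts in ascending order, then after t iterations of the a-handed shuffle the expected number of descents is (1 − a^{−t})(n−1)/2.) -/
open Finset

lemma perm_ai {α : Type*} (f : Equiv.Perm α) (x : α) : f (f⁻¹ x) = x := f.apply_symm_apply x

lemma perm_ia {α : Type*} (f : Equiv.Perm α) (x : α) : f⁻¹ (f x) = x := f.symm_apply_apply x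

lemma mem_desSet_iff_s15 (m : ℕ) (ρ : Equiv.Perm (Fin (m+1))) (p : Fin m) :
    p.val ∈ desSet (m+1) ρ ↔ ρ p.succ < ρ p.castSucc := by
  have hp := p.2
  simp only [desSet, Finset.mem_filter, Finset.mem_range]
  constructor
  · rintro ⟨_, h, h2⟩
    exact h2
  · intro h
    exact ⟨by omega, by omega, h⟩

lemma des_eq_sum (m : ℕ) (ρ : Equiv.Perm (Fin (m+1))) :
    (des (m+1) ρ : ℚ) = ∑ p : Fin m, if ρ p.succ < ρ p.castSucc then (1:ℚ) else 0 := by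
  have h : desSet (m+1) ρ = (Finset.range m).filter (fun i => i ∈ desSet (m+1) ρ) := by
    ext i
    simp [desSet]
  rw [des, h, Finset.card_filter, Finset.sum_range]
  push_cast
  refine Finset.sum_congr rfl fun p _ => ?_
  simp only [mem_desSet_iff_s15]

lemma sort_lt_iff {m a : ℕ} (w : Fin m → Fin a) (x y : Fin m) :
    (Tuple.sort w)⁻¹ x < (Tuple.sort w)⁻¹ y ↔ w x < w y ∨ (w x = w y ∧ x < y) := by
  obtain ⟨h1, h2⟩ := (Tuple.eq_sort_iff (f := w)).1 rfl
  have key : ∀ x y : Fin m, (Tuple.sort w)⁻¹ x < (Tuple.sort w)⁻¹ y →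
      w x < w y ∨ (w x = w y ∧ x < y) := by
    intro x y h
    have a1 := h1 h.le
    have a2 := h2 _ _ h
    simp only [Function.comp, perm_ai] at a1 a2
    rcases a1.lt_or_eq with h | h
    · exact Or.inl h
    · exact Or.inr ⟨h, a2 h⟩
  refine ⟨key x y, fun h => ?_⟩
  by_contra hc
  rcases (not_lt.1 hc).lt_or_eq with h' | h'
  · have := key y x h'
    omega
  · have := (Tuple.sort w)⁻¹.injective h'
    subst this
    simp at h

lemma sort_eq_iff_step {m a : ℕ} (w : Fin (m+1) → Fin a) (ρ : Equiv.Perm (Fin (m+1))) :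
    Tuple.sort w = ρ ↔ ∀ p : Fin m,
      (w (ρ p.castSucc)).val + (if p.val ∈ desSet (m+1) ρ then 1 else 0) ≤ (w (ρ p.succ)).val := by
  have e : Tuple.sort w = ρ ↔ StrictMono (fun i => toLex (w (ρ i), ρ i)) := by
    rw [eq_comm, Tuple.eq_sort_iff']
    rfl
  rw [e, Fin.strictMono_iff_lt_succ]
  refine forall_congr' fun p => ?_
  rw [Prod.Lex.toLex_lt_toLex]
  have hne : ρ p.castSucc ≠ ρ p.succ := by
    intro h
    have := ρ.injective h
    simp [Fin.ext_iff] at this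
  simp only [mem_desSet_iff_s15]
  split_ifs <;> omega

def dcnt (m : ℕ) (ρ : Equiv.Perm (Fin (m+1))) (k : ℕ) : ℕ :=
  ((desSet (m+1) ρ).filter (fun i => i < k)).card

lemma dcnt_succ (m : ℕ) (ρ : Equiv.Perm (Fin (m+1))) (k : ℕ) :
    dcnt m ρ (k+1) = dcnt m ρ k + (if k ∈ desSet (m+1) ρ then 1 else 0) := by
  unfold dcnt
  split_ifs with h
  · have : (desSet (m+1) ρ).filter (fun i => i < k+1)
        = insert k ((desSet (m+1) ρ).filter (fun i => i < k)) := by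
      ext i
      simp only [Finset.mem_filter, Finset.mem_insert]
      constructor
      · rintro ⟨h1, h2⟩
        by_cases hi : i = k
        · exact Or.inl hi
        · exact Or.inr ⟨h1, by omega⟩
      · rintro (rfl | ⟨h1, h2⟩)
        · exact ⟨h, by omega⟩
        · exact ⟨h1, by omega⟩
    rw [this, Finset.card_insert_of_notMem (by simp)]
  · rw [add_zero]
    congr 1
    ext i
    simp only [Finset.mem_filter]
    constructor
    · rintro ⟨h1, h2⟩
      have : i ≠ k := by rintro rfl; exact h h1
      exact ⟨h1, by omega⟩
    · rintro ⟨h1, h2⟩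
      exact ⟨h1, by omega⟩

lemma dcnt_zero (m : ℕ) (ρ : Equiv.Perm (Fin (m+1))) : dcnt m ρ 0 = 0 := by
  simp [dcnt]

lemma dcnt_last (m : ℕ) (ρ : Equiv.Perm (Fin (m+1))) : dcnt m ρ m = des (m+1) ρ := by
  unfold dcnt des
  congr 1
  ext i
  simp only [Finset.mem_filter, and_iff_left_iff_imp]
  intro h
  simp [desSet] at h
  exact h.1

lemma dcnt_bound (m : ℕ) (ρ : Equiv.Perm (Fin (m+1))) (i j : ℕ) :
    dcnt m ρ i ≤ dcnt m ρ (i + j) ∧ dcnt m ρ (i + j) ≤ dcnt m ρ i + j := by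
  induction j with
  | zero => simp
  | succ j ih =>
    have := dcnt_succ m ρ (i+j)
    rw [← add_assoc]
    split_ifs at this <;> omega

lemma strictMono_bound {m N : ℕ} (u : Fin (m+1) → Fin N) (hu : StrictMono u) :
    ∀ (j i : ℕ) (h : i + j < m + 1), (u ⟨i, by omega⟩).val + j ≤ (u ⟨i+j, h⟩).val := by
  intro j
  induction j with
  | zero => intro i h; simp
  | succ j ih =>
    intro i h
    have h1 := ih i (by omega)
    have h2 : u ⟨i+j, by omega⟩ < u ⟨i+(j+1), h⟩ := hu (by simp [Fin.lt_def])
    rw [Fin.lt_def] at h2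
    omega

lemma des_le (m : ℕ) (ρ : Equiv.Perm (Fin (m+1))) : des (m+1) ρ ≤ m := by
  have := (dcnt_bound m ρ 0 m).2
  rw [zero_add, dcnt_last, dcnt_zero] at this
  omega

lemma card_orderEmb_fin (m N : ℕ) :
    Fintype.card (Fin m ↪o Fin N) = N.choose m := by
  rw [← Nat.card_eq_fintype_card, Nat.card_congr (Set.powersetCard.ofFinEmbEquiv)]
  rw [Set.powersetCard.card]
  simp

lemma bd_count (m a : ℕ) (ha : 1 ≤ a) (ρ : Equiv.Perm (Fin (m+1))) :
    (Finset.univ.filter (fun w : Fin (m+1) → Fin a => Tuple.sort w = ρ)).card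
      = (m + 1 + a - 1 - des (m+1) ρ).choose (m+1) := by
  rw [← card_orderEmb_fin, ← Fintype.card_subtype]
  have hd := des_le m ρ
  have hl := dcnt_last m ρ
  have hb1 : ∀ i : Fin (m+1), dcnt m ρ i ≤ i := by
    intro i
    have := (dcnt_bound m ρ 0 i).2
    rw [zero_add, dcnt_zero] at this
    omega
  have hb2 : ∀ i : Fin (m+1), dcnt m ρ i ≤ des (m+1) ρ ∧
      des (m+1) ρ ≤ dcnt m ρ i + (m - i) := by
    intro i
    have := (dcnt_bound m ρ i (m - i))
    rwa [show i.val + (m - i.val) = m by omega, dcnt_last] at this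
  refine Fintype.card_congr
    { toFun := fun w => OrderEmbedding.ofStrictMono
        (fun i => (⟨(w.1 (ρ i)).val + (i - dcnt m ρ i), ?_⟩ :
          Fin (m + 1 + a - 1 - des (m+1) ρ))) ?_
      invFun := fun u => ⟨fun x => ⟨(u (ρ⁻¹ x)).val
          - ((ρ⁻¹ x).val - dcnt m ρ (ρ⁻¹ x)), ?_⟩, ?_⟩
      left_inv := ?_
      right_inv := ?_ }
  · have := (w.1 (ρ i)).2
    have := hb1 i
    have := hb2 i
    omega
  · have hw := (sort_eq_iff_step w.1 ρ).1 w.2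
    rw [Fin.strictMono_iff_lt_succ]
    intro p
    have h1 := hw p
    have h2 := dcnt_succ m ρ p
    have h3 := hb1 p.castSucc
    have h4 := hb1 p.succ
    simp only [Fin.lt_def, Fin.val_succ, Fin.val_castSucc] at *
    omega
  · generalize ρ⁻¹ x = i
    have h1 := strictMono_bound u u.strictMono (m - i) i (by omega)
    have h2 := (u ⟨i + (m - i), by omega⟩).2
    have := hb1 i
    have := hb2 i
    simp only [Fin.eta] at h1
    omega
  · rw [sort_eq_iff_step]
    intro p
    simp only [perm_ia]
    have h1 : u p.castSucc < u p.succ := u.strictMono (Fin.castSucc_lt_succ)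
    have h2 := dcnt_succ m ρ p
    have h3 := hb1 p.castSucc
    have h4 := hb1 p.succ
    have h5 := strictMono_bound u u.strictMono p.val 0 (by omega)
    have h6 : (⟨0 + p.val, by omega⟩ : Fin (m+1)) = p.castSucc := by ext; simp
    rw [h6] at h5
    simp only [Fin.lt_def, Fin.val_succ, Fin.val_castSucc] at *
    omega
  · intro w
    ext x
    simp [perm_ai]
  · intro u
    ext i
    have h5 := strictMono_bound u u.strictMono i.val 0 (by omega)
    have h6 : (⟨0 + i.val, by omega⟩ : Fin (m+1)) = i := by ext; simp
    rw [h6] at h5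
    simp [perm_ia]
    omega

lemma sum_words (m a : ℕ) (ha : 1 ≤ a) (F : Equiv.Perm (Fin (m+1)) → ℚ) :
    ∑ ρ, ((m + 1 + a - 1 - des (m+1) ρ).choose (m+1) : ℚ) * F ρ =
      ∑ w : Fin (m+1) → Fin a, F (Tuple.sort w) := by
  rw [← Finset.sum_fiberwise (s := Finset.univ) (g := fun w : Fin (m+1) → Fin a => Tuple.sort w)]
  refine Finset.sum_congr rfl fun ρ _ => ?_
  rw [← bd_count m a ha ρ, Finset.sum_congr rfl (g := fun _ => F ρ)]
  · rw [Finset.sum_const, nsmul_eq_mul]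
  · intro w hw
    rw [(Finset.mem_filter.1 hw).2]

lemma rank_val {m a : ℕ} (w : Fin m → Fin a) (x : Fin m) :
    ((Tuple.sort w)⁻¹ x).val = ∑ y, if (w y < w x ∨ (w y = w x ∧ y < x)) then 1 else 0 := by
  simp_rw [← sort_lt_iff]
  rw [Equiv.sum_comp (Tuple.sort w)⁻¹ (fun z => if z < (Tuple.sort w)⁻¹ x then 1 else 0)]
  rw [← Finset.card_filter, Finset.filter_gt_eq_Iio, Fin.card_Iio]

lemma predAbove_succ_succAbove' {m : ℕ} (i z : Fin m) :
    i.predAbove (i.succ.succAbove z) = z := by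
  have h := Fin.succ_succAbove_predAbove (p := i) (i := i.succ.succAbove z) (Fin.succAbove_ne _ _)
  exact Fin.succAbove_right_injective h

lemma rank_castSucc {m a : ℕ} (w : Fin m → Fin a) (i : Fin m) :
    (Tuple.sort (w ∘ i.predAbove))⁻¹ i.castSucc = ((Tuple.sort w)⁻¹ i).castSucc := by
  ext
  rw [rank_val, Fin.val_castSucc, rank_val, Fin.sum_univ_succAbove _ i.succ, if_neg, zero_add]
  · refine Finset.sum_congr rfl fun z _ => ?_
    have h : i.succ.succAbove z < i.castSucc ↔ z < i := by
      have h0 : i.castSucc = i.succ.succAbove i := by simp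
      rw [h0, Fin.succAbove_lt_succAbove_iff]
    simp only [Function.comp, predAbove_succ_succAbove', Fin.predAbove_castSucc_self, h]
  · simp [Fin.lt_def]

lemma rank_succ {m a : ℕ} (w : Fin m → Fin a) (i : Fin m) :
    (Tuple.sort (w ∘ i.predAbove))⁻¹ i.succ = ((Tuple.sort w)⁻¹ i).succ := by
  ext
  rw [rank_val, Fin.val_succ, rank_val, Fin.sum_univ_succAbove _ i.castSucc, if_pos, add_comm]
  · congr 1
    refine Finset.sum_congr rfl fun z _ => ?_
    have h : i.castSucc.succAbove z < i.succ ↔ z < i := by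
      have h0 : i.succ = i.castSucc.succAbove i := by simp
      rw [h0, Fin.succAbove_lt_succAbove_iff]
    simp only [Function.comp, Fin.predAbove_succAbove, Fin.predAbove_succ_self, h]
  · simp [Fin.lt_def]

lemma rank_swap {m a : ℕ} (w : Fin m → Fin a) (i j : Fin m) (hij : i.val + 1 = j.val)
    (hw : w i ≠ w j) (x : Fin m) :
    (Tuple.sort (w ∘ Equiv.swap i j))⁻¹ x = (Tuple.sort w)⁻¹ (Equiv.swap i j x) := by
  have h : Equiv.swap i j * Tuple.sort w = Tuple.sort (w ∘ Equiv.swap i j) := by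
    obtain ⟨h1, h2⟩ := (Tuple.eq_sort_iff (f := w)).1 rfl
    rw [Tuple.eq_sort_iff]
    constructor
    · convert h1 using 1
      ext x
      simp
    · intro p q hpq
      simp only [Function.comp, Equiv.Perm.mul_apply, Equiv.swap_apply_self]
      intro he
      have h3 := h2 p q hpq he
      generalize Tuple.sort w p = x at *
      generalize Tuple.sort w q = y at *
      simp only [Equiv.swap_apply_def]
      have : ¬ (x = i ∧ y = j) := by rintro ⟨rfl, rfl⟩; exact hw he
      split_ifs <;> simp_all only [Fin.lt_def, Fin.ext_iff] <;> omega
  rw [← h, mul_inv_rev, Equiv.swap_inv, Equiv.Perm.mul_apply]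

/-- Contribution of words with different letters at the two positions. -/
lemma sum_ne {m a : ℕ} (σ : Equiv.Perm (Fin (m+1))) (i : Fin m) :
    2 * ∑ w : Fin (m+1) → Fin a, (if w i.castSucc ≠ w i.succ then
      (if σ ((Tuple.sort w)⁻¹ i.succ) < σ ((Tuple.sort w)⁻¹ i.castSucc) then (1:ℚ) else 0) else 0)
    = ∑ w : Fin (m+1) → Fin a, (if w i.castSucc ≠ w i.succ then (1:ℚ) else 0) := by
  set G : (Fin (m+1) → Fin a) → ℚ := fun w => (if w i.castSucc ≠ w i.succ then
      (if σ ((Tuple.sort w)⁻¹ i.succ) < σ ((Tuple.sort w)⁻¹ i.castSucc) then (1:ℚ) else 0) else 0)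
    with hG
  have e := Equiv.sum_comp (Equiv.arrowCongr (Equiv.swap i.castSucc i.succ) (Equiv.refl (Fin a))) G
  rw [two_mul]
  nth_rewrite 1 [← e]
  rw [← Finset.sum_add_distrib]
  refine Finset.sum_congr rfl fun w _ => ?_
  have e1 : Equiv.arrowCongr (Equiv.swap i.castSucc i.succ) (Equiv.refl (Fin a)) w
      = w ∘ Equiv.swap i.castSucc i.succ := by
    ext x
    simp [Equiv.arrowCongr]
  rw [e1]
  simp only [hG, Function.comp_apply, Equiv.swap_apply_left, Equiv.swap_apply_right]
  by_cases hw : w i.castSucc ≠ w i.succ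
  · rw [if_pos hw, if_pos hw, if_pos hw.symm, rank_swap w _ _ (by simp) hw,
      rank_swap w _ _ (by simp) hw, Equiv.swap_apply_left, Equiv.swap_apply_right]
    have hne : σ ((Tuple.sort w)⁻¹ i.succ) ≠ σ ((Tuple.sort w)⁻¹ i.castSucc) := by
      intro h
      have := (Tuple.sort w)⁻¹.injective (σ.injective h)
      simp [Fin.ext_iff] at this
    rcases lt_or_gt_of_ne hne with h | h
    · rw [if_neg h.not_gt, if_pos h, zero_add]
    · rw [if_pos h, if_neg h.not_gt, add_zero]
  · rw [if_neg hw, if_neg hw, if_neg (fun h => hw h.symm), add_zero]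

lemma sum_eq_contract {m a : ℕ} (i : Fin m) (F : (Fin (m+1) → Fin a) → ℚ) :
    ∑ w : Fin (m+1) → Fin a, (if w i.castSucc = w i.succ then F w else 0)
      = ∑ w : Fin m → Fin a, F (w ∘ i.predAbove) := by
  rw [← Finset.sum_filter]
  symm
  refine Finset.sum_bij' (fun w _ => w ∘ i.predAbove) (fun w _ => w ∘ i.succ.succAbove)
    ?_ ?_ ?_ ?_ ?_
  · intro w _
    simp
  · intro w _
    simp
  · intro w _
    ext x
    simp [predAbove_succ_succAbove']
  · intro w hw
    have hw := (Finset.mem_filter.1 hw).2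
    funext x
    by_cases hx : x = i.succ
    · subst hx
      simp [hw]
    · simp [Fin.succ_succAbove_predAbove hx]
  · intro w _
    rfl

lemma eq_part {m a : ℕ} (σ : Equiv.Perm (Fin (m+1))) :
    ∑ i : Fin m, ∑ w : Fin (m+1) → Fin a, (if w i.castSucc = w i.succ then
      (if σ ((Tuple.sort w)⁻¹ i.succ) < σ ((Tuple.sort w)⁻¹ i.castSucc) then (1:ℚ) else 0) else 0)
    = (a:ℚ)^m * des (m+1) σ := by
  simp_rw [sum_eq_contract, rank_succ, rank_castSucc]
  rw [Finset.sum_comm]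
  have : ∀ w : Fin m → Fin a, ∑ i : Fin m,
      (if σ ((Tuple.sort w)⁻¹ i).succ < σ ((Tuple.sort w)⁻¹ i).castSucc then (1:ℚ) else 0)
      = des (m+1) σ := by
    intro w
    rw [des_eq_sum, Equiv.sum_comp (Tuple.sort w)⁻¹
      (fun i => if σ i.succ < σ i.castSucc then (1:ℚ) else 0)]
  rw [Finset.sum_congr rfl fun w _ => this w]
  simp

lemma ne_count {m a : ℕ} (i : Fin m) :
    ∑ w : Fin (m+1) → Fin a, (if w i.castSucc ≠ w i.succ then (1:ℚ) else 0)
      = (a:ℚ)^(m+1) - (a:ℚ)^m := by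
  have h := sum_eq_contract (a := a) i (fun _ => (1:ℚ))
  have h2 : ∑ w : Fin (m+1) → Fin a, (if w i.castSucc ≠ w i.succ then (1:ℚ) else 0)
      + ∑ w : Fin (m+1) → Fin a, (if w i.castSucc = w i.succ then (1:ℚ) else 0)
      = ∑ w : Fin (m+1) → Fin a, (1:ℚ) := by
    rw [← Finset.sum_add_distrib]
    refine Finset.sum_congr rfl fun w _ => ?_
    by_cases hw : w i.castSucc = w i.succ <;> simp [hw]
  rw [h] at h2
  simp at h2 ⊢
  linarith

lemma sum_des {m a : ℕ} (σ : Equiv.Perm (Fin (m+1))) :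
    ∑ w : Fin (m+1) → Fin a, (des (m+1) (σ * (Tuple.sort w)⁻¹) : ℚ)
      = (a:ℚ)^m * des (m+1) σ + m * (((a:ℚ)^(m+1) - (a:ℚ)^m) / 2) := by
  simp_rw [des_eq_sum m (σ * _)]
  rw [Finset.sum_comm, ← eq_part (a := a) σ]
  have : (m:ℚ) * (((a:ℚ)^(m+1) - (a:ℚ)^m) / 2)
      = ∑ i : Fin m, (((a:ℚ)^(m+1) - (a:ℚ)^m) / 2) := by simp
  rw [this, ← Finset.sum_add_distrib]
  refine Finset.sum_congr rfl fun i _ => ?_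
  have h := sum_ne (a := a) σ i
  rw [ne_count] at h
  rw [← h, mul_div_cancel_left₀ _ (by norm_num), ← Finset.sum_add_distrib]
  refine Finset.sum_congr rfl fun w _ => ?_
  simp only [Equiv.Perm.mul_apply]
  by_cases hw : w i.castSucc = w i.succ
  · rw [if_pos hw, if_neg (not_not.2 hw), add_zero]
    congr
  · rw [if_neg hw, if_pos hw, zero_add]
    congr

lemma Pa_mulVec (m a : ℕ) (ha : 1 ≤ a) (f : Equiv.Perm (Fin (m+1)) → ℚ)
    (σ : Equiv.Perm (Fin (m+1))) :
    (Pa (m+1) a).mulVec f σ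
      = (∑ w : Fin (m+1) → Fin a, f (σ * (Tuple.sort w)⁻¹)) / (a:ℚ)^(m+1) := by
  rw [← sum_words m a ha (fun ρ => f (σ * ρ⁻¹)), Finset.sum_div]
  simp only [Matrix.mulVec, dotProduct, Pa]
  rw [← Equiv.sum_comp ((Equiv.inv _).trans (Equiv.mulLeft σ))]
  refine Finset.sum_congr rfl fun ρ _ => ?_
  simp [div_mul_eq_mul_div]

lemma main_step (m a : ℕ) (ha : 1 ≤ a) (c d : ℚ) :
    (Pa (m+1) a).mulVec (fun τ => c * (des (m+1) τ : ℚ) + d)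
      = fun σ => c / a * des (m+1) σ + (d + c * (1 - (a:ℚ)⁻¹) * m / 2) := by
  have ha' : (a:ℚ) ≠ 0 := by positivity
  ext σ
  rw [Pa_mulVec m a ha, Finset.sum_add_distrib, ← Finset.mul_sum, sum_des]
  simp
  field_simp
  ring

lemma main_iter (m a : ℕ) (ha : 1 ≤ a) (t : ℕ) :
    ((Pa (m+1) a) ^ t).mulVec (fun τ => (des (m+1) τ : ℚ))
      = fun τ => ((a : ℚ) ^ t)⁻¹ * (des (m+1) τ : ℚ) + (1 - ((a : ℚ) ^ t)⁻¹) * m / 2 := by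
  have ha' : (a:ℚ) ≠ 0 := by positivity
  induction t with
  | zero => simp
  | succ t ih =>
    rw [pow_succ', ← Matrix.mulVec_mulVec, ih, main_step m a ha]
    ext σ
    field_simp
    ring

/-- Starting from the ascending deck, the expected number of descents after `t`
iterations of the `a`-handed shuffle is `(1 - a^{-t})(n-1)/2`. -/
theorem stmt15 (n a : ℕ) (hn : 1 ≤ n) (ha : 1 ≤ a) (t : ℕ) :
    ((Pa n a) ^ t).mulVec (fun τ => (des n τ : ℚ)) 1 =
      (1 - ((a : ℚ) ^ t)⁻¹) * ((n : ℚ) - 1) / 2 := by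
  obtain ⟨m, rfl⟩ : ∃ m, n = m + 1 := ⟨n - 1, by omega⟩
  rw [main_iter m a ha t]
  have h : des (m+1) 1 = 0 := by
    have := des_eq_sum m 1
    rw [Finset.sum_eq_zero] at this
    · exact_mod_cast this
    · intro p _
      rw [if_neg]
      simp [Fin.lt_def]
  simp [h]
end
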